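/- Let X ⊂ ℝ^d be a relatively separated set, u an admissible weight, δ, s > 0 with u(x) ≥ (1+|x|)^δ for all x ∈ ℝ^d, and set ν(x) = u(x)(1+|x|)^s. Then the algebra B_{u,s}(X), consisting of all B(H)-valued matrices A with finite norm ‖A‖_{B_{u,s}} = 2^s ‖A‖_{S_u^1} + ‖A‖_{J_ν}, is inverse-closed in B(ℓ²(X;H)): if A has finite B_{u,s}-norm and the bounded operator on ℓ²(X;H) that A defines is invertible, then the canonical matrix representation of the inverse operator also has finite B_{u,s}-norm (both its S_u^1-norm and J_ν-norm are finite). -/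

import Mathlib

open scoped ENNReal
open Set Filter

noncomputable section

/-- `ℝ^d` with the Euclidean norm. -/
abbrev Euc (d : ℕ) := EuclideanSpace ℝ (Fin d)

/-- A set `X ⊂ ℝ^d` is relatively separated if
`sup_{x ∈ ℝ^d} #(X ∩ (x + [0,1]^d)) < ∞`. -/
def RelSep {d : ℕ} (X : Set (Euc d)) : Prop :=
  ∃ N : ℕ, ∀ x : Euc d,
    (X ∩ {y | ∀ j, x j ≤ y j ∧ y j ≤ x j + 1}).Finite ∧
    (X ∩ {y | ∀ j, x j ≤ y j ∧ y j ≤ x j + 1}).ncard ≤ N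

/-- A function `nrm : ℝ^d → ℝ` is a norm on `ℝ^d`. -/
def IsNormOn {d : ℕ} (nrm : Euc d → ℝ) : Prop :=
  (∀ x, 0 ≤ nrm x) ∧ (∀ x, nrm x = 0 ↔ x = 0) ∧
  (∀ (c : ℝ) (x), nrm (c • x) = |c| * nrm x) ∧
  (∀ x y, nrm (x + y) ≤ nrm x + nrm y)

/-- An admissible weight: `u(x) = e^{ρ(‖x‖)}` for some continuous concave
`ρ : [0,∞) → [0,∞)` with `ρ(0) = 0` and some norm `‖·‖` on `ℝ^d`, and `u`
satisfies the GRS-condition. -/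
def Admissible {d : ℕ} (u : Euc d → ℝ) : Prop :=
  (∃ (ρ : ℝ → ℝ) (nrm : Euc d → ℝ), IsNormOn nrm ∧
      ContinuousOn ρ (Set.Ici 0) ∧ ConcaveOn ℝ (Set.Ici 0) ρ ∧ ρ 0 = 0 ∧
      (∀ t ∈ Set.Ici (0 : ℝ), 0 ≤ ρ t) ∧ (∀ x, u x = Real.exp (ρ (nrm x)))) ∧
  (∀ z : Euc d, Tendsto (fun n : ℕ => (u ((n : ℝ) • z)) ^ (1 / (n : ℝ)))
    atTop (nhds 1))

/-- Membership in the Schur class `S_w^1(X)`. -/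
def MemSchur1 {d : ℕ} {X : Set (Euc d)} {H : Type*}
    [NormedAddCommGroup H] [InnerProductSpace ℂ H]
    (w : Euc d → ℝ) (A : ↥X → ↥X → (H →L[ℂ] H)) : Prop :=
  (∀ k : ↥X, Summable fun l : ↥X => ‖A k l‖ * w ((k : Euc d) - (l : Euc d))) ∧
  BddAbove (Set.range fun k : ↥X => ∑' l : ↥X, ‖A k l‖ * w ((k : Euc d) - (l : Euc d))) ∧
  (∀ l : ↥X, Summable fun k : ↥X => ‖A k l‖ * w ((k : Euc d) - (l : Euc d))) ∧
  BddAbove (Set.range fun l : ↥X => ∑' k : ↥X, ‖A k l‖ * w ((k : Euc d) - (l : Euc d)))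

/-- Finiteness of the `J_w`-norm `sup_{k,l ∈ X} ‖A_{k,l}‖ w(k-l)`. -/
def MemJnu {d : ℕ} {X : Set (Euc d)} {H : Type*}
    [NormedAddCommGroup H] [InnerProductSpace ℂ H]
    (w : Euc d → ℝ) (A : ↥X → ↥X → (H →L[ℂ] H)) : Prop :=
  BddAbove (Set.range fun q : ↥X × ↥X => ‖A q.1 q.2‖ * w ((q.1 : Euc d) - (q.2 : Euc d)))

/-- The sequence `δ_l f ∈ ℓ^p(X;H)` equal to `f` at index `l` and `0` elsewhere. -/
noncomputable def deltaSeq {X : Type*} {H : Type*} [NormedAddCommGroup H]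
    (p : ℝ≥0∞) (l : X) (f : H) : lp (fun _ : X => H) p :=
  haveI := Classical.decEq X
  lp.single p l f

section EntrywiseMajorants

variable {ι : Type*}

/-- The largest weighted row sum of a matrix with entries in `[0, ∞]`. -/
def rowNorm (ω a : ι → ι → ℝ≥0∞) : ℝ≥0∞ := ⨆ k, ∑' l, a k l * ω k l

/-- The weighted Schur norm of a matrix with entries in `[0, ∞]`. -/
def schurNorm (ω a : ι → ι → ℝ≥0∞) : ℝ≥0∞ :=
  max (rowNorm ω a) (rowNorm (Function.swap ω) (Function.swap a))

/-- The weighted supremum norm of a matrix with entries in `[0, ∞]`. -/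
def entryNorm (ω a : ι → ι → ℝ≥0∞) : ℝ≥0∞ := ⨆ k, ⨆ l, a k l * ω k l

/-- The product of two matrices with entries in `[0, ∞]`. -/
def majMul (a b : ι → ι → ℝ≥0∞) (k l : ι) : ℝ≥0∞ := ∑' j, a k j * b j l

variable {ω ω₁ ω₂ ω₃ ω₄ ν a b : ι → ι → ℝ≥0∞}

lemma swap_majMul (a b : ι → ι → ℝ≥0∞) :
    Function.swap (majMul a b) = majMul (Function.swap b) (Function.swap a) := by
  funext k l
  simp [majMul, Function.swap, mul_comm]

lemma rowNorm_mono (h : ∀ k l, a k l * ω₁ k l ≤ b k l * ω₂ k l) :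
    rowNorm ω₁ a ≤ rowNorm ω₂ b :=
  iSup_mono fun k => ENNReal.tsum_le_tsum fun l => h k l

lemma schurNorm_mono (h : ∀ k l, a k l * ω₁ k l ≤ b k l * ω₂ k l) :
    schurNorm ω₁ a ≤ schurNorm ω₂ b :=
  max_le_max (rowNorm_mono h) (rowNorm_mono fun k l => h l k)

lemma entryNorm_mono (h : ∀ k l, a k l * ω₁ k l ≤ b k l * ω₂ k l) :
    entryNorm ω₁ a ≤ entryNorm ω₂ b :=
  iSup_mono fun k => iSup_mono fun l => h k l

lemma tsum_row_le (k : ι) : ∑' l, a k l * ω k l ≤ schurNorm ω a :=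
  (le_iSup (fun k => ∑' l, a k l * ω k l) k).trans (le_max_left _ _)

lemma tsum_col_le (l : ι) : ∑' k, a k l * ω k l ≤ schurNorm ω a :=
  (le_iSup (fun l => ∑' k, a k l * ω k l) l).trans (le_max_right _ _)

lemma mul_weight_le_entryNorm (k l : ι) : a k l * ω k l ≤ entryNorm ω a :=
  le_iSup₂ (f := fun k l => a k l * ω k l) k l

lemma schurNorm_le {C : ℝ≥0∞} (h₁ : ∀ k, ∑' l, a k l * ω k l ≤ C)
    (h₂ : ∀ l, ∑' k, a k l * ω k l ≤ C) : schurNorm ω a ≤ C :=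
  max_le (iSup_le h₁) (iSup_le h₂)

lemma schurNorm_swap (hω : ∀ k l, ω k l = ω l k) :
    schurNorm ω (Function.swap a) = schurNorm ω a := by
  have h : Function.swap ω = ω := by
    funext k l
    exact hω l k
  rw [schurNorm, schurNorm, h, max_comm]

lemma entryNorm_swap (hω : ∀ k l, ω k l = ω l k) :
    entryNorm ω (Function.swap a) = entryNorm ω a := by
  rw [entryNorm, entryNorm, iSup_comm]
  simp only [Function.swap, hω]

lemma schurNorm_smul (c : ℝ≥0∞) :
    schurNorm ω (fun k l => c * a k l) = c * schurNorm ω a := by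
  simp only [schurNorm, rowNorm, Function.swap, mul_assoc, ENNReal.tsum_mul_left,
    ← ENNReal.mul_iSup]
  exact ((mul_right_mono (a := c)).map_max).symm

lemma entryNorm_smul (c : ℝ≥0∞) :
    entryNorm ω (fun k l => c * a k l) = c * entryNorm ω a := by
  simp only [entryNorm, mul_assoc, ← ENNReal.mul_iSup]

lemma schurNorm_smul_weight (c : ℝ≥0∞) :
    schurNorm (fun k l => c * ω k l) a = c * schurNorm ω a := by
  rw [← schurNorm_smul]
  simp only [schurNorm, rowNorm, Function.swap, mul_left_comm, mul_assoc]

lemma schurNorm_add_le :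
    schurNorm ω (fun k l => a k l + b k l) ≤ schurNorm ω a + schurNorm ω b := by
  refine schurNorm_le (fun k => ?_) fun l => ?_
  · simp only [add_mul, ENNReal.tsum_add]
    exact add_le_add (tsum_row_le k) (tsum_row_le k)
  · simp only [add_mul, ENNReal.tsum_add]
    exact add_le_add (tsum_col_le l) (tsum_col_le l)

lemma schurNorm_tsum_le {κ : Type*} (f : κ → ι → ι → ℝ≥0∞) :
    schurNorm ω (fun k l => ∑' n, f n k l) ≤ ∑' n, schurNorm ω (f n) := by
  refine schurNorm_le (fun k => ?_) fun l => ?_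
  · simp only [← ENNReal.tsum_mul_right]
    rw [ENNReal.tsum_comm]
    exact ENNReal.tsum_le_tsum fun n => tsum_row_le k
  · simp only [← ENNReal.tsum_mul_right]
    rw [ENNReal.tsum_comm]
    exact ENNReal.tsum_le_tsum fun n => tsum_col_le l

lemma entryNorm_tsum_le {κ : Type*} (f : κ → ι → ι → ℝ≥0∞) :
    entryNorm ω (fun k l => ∑' n, f n k l) ≤ ∑' n, entryNorm ω (f n) := by
  refine iSup₂_le fun k l => ?_
  rw [← ENNReal.tsum_mul_right]
  exact ENNReal.tsum_le_tsum fun n => mul_weight_le_entryNorm k l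

lemma rowNorm_majMul_le
    (h : ∀ k j l, ω k l ≤ ω₁ k j * ω₂ j l + ω₃ k j * ω₄ j l) :
    rowNorm ω (majMul a b) ≤
      rowNorm ω₁ a * rowNorm ω₂ b + rowNorm ω₃ a * rowNorm ω₄ b := by
  have key : ∀ (σ τ : ι → ι → ℝ≥0∞) (k : ι),
      ∑' j, (a k j * σ k j) * ∑' l, b j l * τ j l ≤ rowNorm σ a * rowNorm τ b := by
    intro σ τ k
    calc ∑' j, (a k j * σ k j) * ∑' l, b j l * τ j l
        ≤ ∑' j, (a k j * σ k j) * rowNorm τ b := by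
          refine ENNReal.tsum_le_tsum fun j => mul_le_mul_right ?_ _
          exact le_iSup (fun k => ∑' l, b k l * τ k l) j
      _ = (∑' j, a k j * σ k j) * rowNorm τ b := ENNReal.tsum_mul_right
      _ ≤ _ := by
          refine mul_le_mul_left ?_ _
          exact le_iSup (fun k => ∑' l, a k l * σ k l) k
  refine iSup_le fun k => ?_
  calc ∑' l, majMul a b k l * ω k l
      ≤ ∑' l, ∑' j, ((a k j * ω₁ k j) * (b j l * ω₂ j l)
          + (a k j * ω₃ k j) * (b j l * ω₄ j l)) := by
        refine ENNReal.tsum_le_tsum fun l => ?_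
        rw [majMul, ← ENNReal.tsum_mul_right]
        refine ENNReal.tsum_le_tsum fun j => ?_
        calc a k j * b j l * ω k l
            ≤ a k j * b j l * (ω₁ k j * ω₂ j l + ω₃ k j * ω₄ j l) :=
              mul_le_mul_right (h k j l) _
          _ = _ := by ring
    _ = ∑' j, (a k j * ω₁ k j) * ∑' l, b j l * ω₂ j l
          + ∑' j, (a k j * ω₃ k j) * ∑' l, b j l * ω₄ j l := by
        rw [ENNReal.tsum_comm]
        simp only [ENNReal.tsum_add, ENNReal.tsum_mul_left]
    _ ≤ _ := add_le_add (key _ _ k) (key _ _ k)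

lemma schurNorm_majMul_le_add
    (h : ∀ k j l, ω k l ≤ ω₁ k j * ω₂ j l + ω₃ k j * ω₄ j l) :
    schurNorm ω (majMul a b) ≤
      schurNorm ω₁ a * schurNorm ω₂ b + schurNorm ω₃ a * schurNorm ω₄ b := by
  refine max_le ?_ ?_
  · refine (rowNorm_majMul_le h).trans ?_
    gcongr <;> exact le_max_left _ _
  · rw [swap_majMul]
    refine (rowNorm_majMul_le (ω₁ := Function.swap ω₂) (ω₂ := Function.swap ω₁)
      (ω₃ := Function.swap ω₄) (ω₄ := Function.swap ω₃) fun k j l => ?_).trans ?_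
    · simpa only [Function.swap, mul_comm] using h l j k
    · rw [mul_comm (schurNorm ω₁ a), mul_comm (schurNorm ω₃ a)]
      gcongr <;> exact le_max_right _ _

lemma schurNorm_majMul_le (h : ∀ k j l, ω k l ≤ ω k j * ω j l) :
    schurNorm ω (majMul a b) ≤ schurNorm ω a * schurNorm ω b := by
  have h0 : schurNorm (fun _ _ => 0) a = 0 := by simp [schurNorm, rowNorm, Function.swap]
  simpa [h0] using schurNorm_majMul_le_add (a := a) (b := b) (ω₃ := fun _ _ => 0)
    (ω₄ := fun _ _ => 0) fun k j l => (h k j l).trans le_self_add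

lemma entryNorm_majMul_le {c : ℝ≥0∞}
    (h : ∀ k j l, ν k l ≤ c * (ν k j * ω j l + ω k j * ν j l)) :
    entryNorm ν (majMul a b) ≤
      c * (entryNorm ν a * schurNorm ω b + schurNorm ω a * entryNorm ν b) := by
  refine iSup₂_le fun k l => ?_
  calc majMul a b k l * ν k l
      ≤ ∑' j, c * ((a k j * ν k j) * (b j l * ω j l) + (a k j * ω k j) * (b j l * ν j l)) := by
        rw [majMul, ← ENNReal.tsum_mul_right]
        refine ENNReal.tsum_le_tsum fun j => ?_
        calc a k j * b j l * ν k l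
            ≤ a k j * b j l * (c * (ν k j * ω j l + ω k j * ν j l)) :=
              mul_le_mul_right (h k j l) _
          _ = _ := by ring
    _ ≤ ∑' j, c * (entryNorm ν a * (b j l * ω j l) + (a k j * ω k j) * entryNorm ν b) := by
        refine ENNReal.tsum_le_tsum fun j => ?_
        gcongr
        · exact mul_weight_le_entryNorm k j
        · exact mul_weight_le_entryNorm j l
    _ = c * (entryNorm ν a * ∑' j, b j l * ω j l + (∑' j, a k j * ω k j) * entryNorm ν b) := by
        simp only [ENNReal.tsum_add, ENNReal.tsum_mul_left, ENNReal.tsum_mul_right]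
    _ ≤ _ := by
        gcongr
        · exact tsum_col_le l
        · exact tsum_row_le k

end EntrywiseMajorants

section OperatorEntries

variable {ι H : Type*} [NormedAddCommGroup H]

lemma norm_deltaSeq (l : ι) (f : H) : ‖(deltaSeq 2 l f : lp (fun _ : ι => H) 2)‖ = ‖f‖ := by
  classical
  exact lp.norm_single (E := fun _ => H) (p := 2) (by norm_num) l f

lemma hasSum_deltaSeq (g : lp (fun _ : ι => H) 2) : HasSum (fun j => deltaSeq 2 j (g j)) g := by
  classical
  exact lp.hasSum_single (by norm_num) g

lemma deltaSeq_self (l : ι) (f : H) : (deltaSeq 2 l f : lp (fun _ : ι => H) 2) l = f := by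
  classical
  exact lp.single_apply_self (E := fun _ => H) 2 l f

lemma deltaSeq_ne {k l : ι} (h : k ≠ l) (f : H) :
    (deltaSeq 2 l f : lp (fun _ : ι => H) 2) k = 0 := by
  classical
  exact lp.single_apply_ne (E := fun _ => H) 2 l f h

variable [InnerProductSpace ℂ H]

/-- The `(k, l)` entry of the canonical matrix representation of a bounded operator. -/
def opEntry (R : lp (fun _ : ι => H) 2 →L[ℂ] lp (fun _ : ι => H) 2) (k l : ι) : H →L[ℂ] H :=
  haveI := Classical.decEq ι
  (lp.evalCLM ℂ (fun _ : ι => H) 2 k).comp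
    (R.comp (lp.singleContinuousLinearMap ℂ (fun _ : ι => H) 2 l))

lemma opEntry_apply (R : lp (fun _ : ι => H) 2 →L[ℂ] lp (fun _ : ι => H) 2) (k l : ι) (f : H) :
    opEntry R k l f = R (deltaSeq 2 l f) k := rfl

/-- The norms of the entries of the canonical matrix representation. -/
def entryEnorm (R : lp (fun _ : ι => H) 2 →L[ℂ] lp (fun _ : ι => H) 2) (k l : ι) : ℝ≥0∞ :=
  ‖opEntry R k l‖ₑ

variable (R R' : lp (fun _ : ι => H) 2 →L[ℂ] lp (fun _ : ι => H) 2)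

lemma hasSum_opEntry (g : lp (fun _ : ι => H) 2) (k : ι) :
    HasSum (fun j => opEntry R k j (g j)) (R g k) :=
  (hasSum_deltaSeq g).mapL ((lp.evalCLM ℂ (fun _ : ι => H) 2 k).comp R)

lemma entryEnorm_le_of_forall {k l : ι} {C : ℝ≥0∞}
    (h : ∀ f, ‖opEntry R k l f‖ₑ ≤ C * ‖f‖ₑ) : entryEnorm R k l ≤ C :=
  ContinuousLinearMap.opENorm_le_bound _ h

lemma enorm_opEntry_apply_le (k l : ι) (f : H) :
    ‖opEntry R k l f‖ₑ ≤ entryEnorm R k l * ‖f‖ₑ :=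
  ContinuousLinearMap.le_opENorm _ _

lemma entryEnorm_mul_le (k l : ι) :
    entryEnorm (R * R') k l ≤ majMul (entryEnorm R) (entryEnorm R') k l := by
  refine entryEnorm_le_of_forall _ fun f => ?_
  have h : opEntry (R * R') k l f = ∑' j, opEntry R k j (opEntry R' j l f) :=
    (hasSum_opEntry R (R' (deltaSeq 2 l f)) k).tsum_eq.symm
  rw [h, majMul, ← ENNReal.tsum_mul_right]
  refine enorm_tsum_le_tsum_enorm.trans (ENNReal.tsum_le_tsum fun j => ?_)
  rw [mul_assoc]
  exact (enorm_opEntry_apply_le _ _ _ _).trans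
    (mul_le_mul_right (enorm_opEntry_apply_le _ _ _ _) _)

lemma entryEnorm_le (k l : ι) : entryEnorm R k l ≤ ‖R‖ₑ := by
  refine entryEnorm_le_of_forall _ fun f => ?_
  rw [opEntry_apply]
  calc ‖R (deltaSeq 2 l f) k‖ₑ ≤ ‖R (deltaSeq 2 l f)‖ₑ := by
        simpa [enorm_le_iff_norm_le] using lp.norm_apply_le_norm (by norm_num) _ k
    _ ≤ ‖R‖ₑ * ‖(deltaSeq 2 l f : lp (fun _ : ι => H) 2)‖ₑ := R.le_opENorm _
    _ = ‖R‖ₑ * ‖f‖ₑ := by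
        congr 1
        simp [enorm_eq_iff_norm_eq, norm_deltaSeq]

lemma entryEnorm_smul (c : ℂ) (k l : ι) : entryEnorm (c • R) k l = ‖c‖ₑ * entryEnorm R k l := by
  have h : opEntry (c • R) k l = c • opEntry R k l := by
    ext f
    rfl
  rw [entryEnorm, h, enorm_smul, entryEnorm]

lemma entryEnorm_one_self_le (k : ι) :
    entryEnorm (1 : lp (fun _ : ι => H) 2 →L[ℂ] lp (fun _ : ι => H) 2) k k ≤ 1 := by
  refine entryEnorm_le_of_forall _ fun f => ?_
  rw [opEntry_apply, one_apply_eq_self, deltaSeq_self, one_mul]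

lemma entryEnorm_one_ne {k l : ι} (h : k ≠ l) :
    entryEnorm (1 : lp (fun _ : ι => H) 2 →L[ℂ] lp (fun _ : ι => H) 2) k l = 0 := by
  refine le_antisymm (entryEnorm_le_of_forall _ fun f => ?_) zero_le
  rw [opEntry_apply, one_apply_eq_self, deltaSeq_ne h]
  simp

lemma entryEnorm_tsum_le {κ : Type*}
    {f : κ → lp (fun _ : ι => H) 2 →L[ℂ] lp (fun _ : ι => H) 2} (hf : Summable f) (k l : ι) :
    entryEnorm (∑' n, f n) k l ≤ ∑' n, entryEnorm (f n) k l := by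
  refine entryEnorm_le_of_forall _ fun x => ?_
  have h : HasSum (fun n => opEntry (f n) k l x) (opEntry (∑' n, f n) k l x) :=
    hf.hasSum.mapL ((lp.evalCLM ℂ (fun _ : ι => H) 2 k).comp
      (ContinuousLinearMap.apply ℂ (lp (fun _ : ι => H) 2) (deltaSeq 2 l x)))
  rw [← h.tsum_eq, ← ENNReal.tsum_mul_right]
  exact enorm_tsum_le_tsum_enorm.trans
    (ENNReal.tsum_le_tsum fun n => enorm_opEntry_apply_le _ _ _ _)

lemma entryEnorm_adjoint [CompleteSpace H] :
    entryEnorm (ContinuousLinearMap.adjoint R) = Function.swap (entryEnorm R) := by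
  classical
  funext k l
  have h : opEntry (ContinuousLinearMap.adjoint R) k l
      = ContinuousLinearMap.adjoint (opEntry R l k) := by
    rw [ContinuousLinearMap.eq_adjoint_iff]
    intro x y
    have h₁ : inner ℂ (ContinuousLinearMap.adjoint R (deltaSeq 2 l x)) (deltaSeq 2 k y)
        = inner ℂ (opEntry (ContinuousLinearMap.adjoint R) k l x) y := by
      rw [opEntry_apply, deltaSeq, deltaSeq]
      convert lp.inner_single_right (𝕜 := ℂ) (G := fun _ : ι => H) k y _
    have h₂ : inner ℂ (deltaSeq 2 l x) (R (deltaSeq 2 k y)) = inner ℂ x (opEntry R l k y) := by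
      rw [opEntry_apply, deltaSeq, deltaSeq]
      convert lp.inner_single_left (𝕜 := ℂ) (G := fun _ : ι => H) l x _
    rw [← h₁, ← h₂, ContinuousLinearMap.adjoint_inner_left]
  rw [Function.swap, entryEnorm, h, entryEnorm, ← ofReal_norm, ← ofReal_norm,
    LinearIsometryEquiv.norm_map]

end OperatorEntries

section WeightedOperators

variable {ι H : Type*} [NormedAddCommGroup H] [InnerProductSpace ℂ H]
  {ω v ν : ι → ι → ℝ≥0∞} {R R' : lp (fun _ : ι => H) 2 →L[ℂ] lp (fun _ : ι => H) 2}

lemma schurNorm_entryEnorm_one_le (h : ∀ k, ω k k ≤ 1) :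
    schurNorm ω
      (entryEnorm (1 : lp (fun _ : ι => H) 2 →L[ℂ] lp (fun _ : ι => H) 2)) ≤ 1 := by
  refine schurNorm_le (fun k => ?_) fun l => ?_
  · rw [tsum_eq_single k fun l hl => by rw [entryEnorm_one_ne hl.symm, zero_mul]]
    exact mul_le_one' (entryEnorm_one_self_le k) (h k)
  · rw [tsum_eq_single l fun k hk => by rw [entryEnorm_one_ne hk, zero_mul]]
    exact mul_le_one' (entryEnorm_one_self_le l) (h l)

lemma entryNorm_entryEnorm_one_le (h : ∀ k, ν k k ≤ 1) :
    entryNorm ν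
      (entryEnorm (1 : lp (fun _ : ι => H) 2 →L[ℂ] lp (fun _ : ι => H) 2)) ≤ 1 := by
  refine iSup₂_le fun k l => ?_
  rcases eq_or_ne k l with rfl | hkl
  · exact mul_le_one' (entryEnorm_one_self_le k) (h k)
  · simp [entryEnorm_one_ne hkl]

lemma schurNorm_entryEnorm_mul_le (h : ∀ k j l, ω k l ≤ ω k j * ω j l) :
    schurNorm ω (entryEnorm (R * R')) ≤
      schurNorm ω (entryEnorm R) * schurNorm ω (entryEnorm R') :=
  (schurNorm_mono fun k l => mul_le_mul_left (entryEnorm_mul_le R R' k l) _).trans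
    (schurNorm_majMul_le h)

lemma entryNorm_entryEnorm_mul_le {c : ℝ≥0∞}
    (h : ∀ k j l, ν k l ≤ c * (ν k j * ω j l + ω k j * ν j l)) :
    entryNorm ν (entryEnorm (R * R')) ≤
      c * (entryNorm ν (entryEnorm R) * schurNorm ω (entryEnorm R')
        + schurNorm ω (entryEnorm R) * entryNorm ν (entryEnorm R')) :=
  (entryNorm_mono fun k l => mul_le_mul_left (entryEnorm_mul_le R R' k l) _).trans
    (entryNorm_majMul_le h)

lemma schurNorm_entryEnorm_pow_le (h₁ : ∀ k, ω k k ≤ 1)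
    (h : ∀ k j l, ω k l ≤ ω k j * ω j l) (n : ℕ) :
    schurNorm ω (entryEnorm (R ^ n)) ≤ schurNorm ω (entryEnorm R) ^ n := by
  induction n with
  | zero => simpa using schurNorm_entryEnorm_one_le h₁
  | succ n ih =>
    rw [pow_succ, pow_succ]
    exact (schurNorm_entryEnorm_mul_le h).trans (mul_le_mul_left ih _)

/-- If `v` is weakly subadditive, the `v`-Schur norm of a square is controlled by the product of
the weighted and the unweighted Schur norm. -/
lemma schurNorm_entryEnorm_sq_le {c : ℝ≥0∞} (h : ∀ k j l, v k l ≤ c * (v k j + v j l)) :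
    schurNorm v (entryEnorm (R * R)) ≤
      2 * c * (schurNorm v (entryEnorm R) * schurNorm (fun _ _ => 1) (entryEnorm R)) := by
  have h' : ∀ k j l, v k l ≤ (c * v k j) * 1 + c * v j l := fun k j l =>
    (h k j l).trans_eq (by ring)
  calc schurNorm v (entryEnorm (R * R))
      ≤ schurNorm v (majMul (entryEnorm R) (entryEnorm R)) :=
        schurNorm_mono fun k l => mul_le_mul_left (entryEnorm_mul_le R R k l) _
    _ ≤ schurNorm (fun k l => c * v k l) (entryEnorm R) * schurNorm (fun _ _ => 1) (entryEnorm R)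
          + schurNorm (fun _ _ => c * 1) (entryEnorm R) * schurNorm v (entryEnorm R) :=
        schurNorm_majMul_le_add fun k j l => by simpa using h' k j l
    _ = _ := by
        rw [schurNorm_smul_weight, schurNorm_smul_weight (ω := fun _ _ => 1)]
        ring

lemma entryNorm_entryEnorm_pow_le {c : ℝ≥0∞} (hω₁ : ∀ k, ω k k ≤ 1)
    (hω : ∀ k j l, ω k l ≤ ω k j * ω j l) (hν₁ : ∀ k, ν k k ≤ 1)
    (hν : ∀ k j l, ν k l ≤ c * (ν k j * ω j l + ω k j * ν j l))
    (hR : schurNorm ω (entryEnorm R) ≤ 4⁻¹) (hcR : c * schurNorm ω (entryEnorm R) ≤ 4⁻¹) (n : ℕ) :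
    entryNorm ν (entryEnorm (R ^ n)) ≤
      (1 + 4 * (c * entryNorm ν (entryEnorm R))) * 2⁻¹ ^ n := by
  have h44 : (4 : ℝ≥0∞)⁻¹ * 4 = 1 := ENNReal.inv_mul_cancel (by norm_num) (by norm_num)
  have h42 : (4 : ℝ≥0∞)⁻¹ + 4⁻¹ = 2⁻¹ := by
    have h : (4 : ℝ≥0∞) = 2 * 2 := by norm_num
    rw [h, ENNReal.mul_inv (by simp) (by simp), ← mul_add, ENNReal.inv_two_add_inv_two, mul_one]
  induction n with
  | zero =>
    simpa using (entryNorm_entryEnorm_one_le (H := H) hν₁).trans le_self_add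
  | succ n ih =>
    set J := entryNorm ν (entryEnorm R)
    set C := 1 + 4 * (c * J) with hC
    have hn : schurNorm ω (entryEnorm (R ^ n)) ≤ 2⁻¹ ^ n := by
      refine (schurNorm_entryEnorm_pow_le hω₁ hω n).trans (pow_le_pow_left₀ zero_le ?_ n)
      exact hR.trans (ENNReal.inv_le_inv.2 (by norm_num))
    rw [pow_succ']
    calc entryNorm ν (entryEnorm (R * R ^ n))
        ≤ c * (J * schurNorm ω (entryEnorm (R ^ n))
            + schurNorm ω (entryEnorm R) * entryNorm ν (entryEnorm (R ^ n))) :=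
          entryNorm_entryEnorm_mul_le hν
      _ ≤ c * (J * 2⁻¹ ^ n + schurNorm ω (entryEnorm R) * (C * 2⁻¹ ^ n)) := by gcongr
      _ = (c * J + c * schurNorm ω (entryEnorm R) * C) * 2⁻¹ ^ n := by ring
      _ ≤ (4⁻¹ * C + 4⁻¹ * C) * 2⁻¹ ^ n := by
          refine mul_le_mul_left (add_le_add ?_ (mul_le_mul_left hcR _)) _
          calc c * J = 4⁻¹ * (4 * (c * J)) := by rw [← mul_assoc, h44, one_mul]
            _ ≤ 4⁻¹ * C := by gcongr; exact le_add_self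
      _ = C * 2⁻¹ ^ (n + 1) := by rw [← add_mul, h42]; ring

/-- The operator has finite weighted Schur norm and finite weighted supremum norm. -/
def HasDecay (ω ν : ι → ι → ℝ≥0∞)
    (R : lp (fun _ : ι => H) 2 →L[ℂ] lp (fun _ : ι => H) 2) : Prop :=
  schurNorm ω (entryEnorm R) ≠ ⊤ ∧ entryNorm ν (entryEnorm R) ≠ ⊤

namespace HasDecay

lemma one (hω₁ : ∀ k, ω k k ≤ 1) (hν₁ : ∀ k, ν k k ≤ 1) :
    HasDecay ω ν (1 : lp (fun _ : ι => H) 2 →L[ℂ] lp (fun _ : ι => H) 2) :=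
  ⟨ne_top_of_le_ne_top ENNReal.one_ne_top (schurNorm_entryEnorm_one_le hω₁),
    ne_top_of_le_ne_top ENNReal.one_ne_top (entryNorm_entryEnorm_one_le hν₁)⟩

lemma mul {c : ℝ≥0∞} (hc : c ≠ ⊤) (hω : ∀ k j l, ω k l ≤ ω k j * ω j l)
    (hν : ∀ k j l, ν k l ≤ c * (ν k j * ω j l + ω k j * ν j l))
    (h : HasDecay ω ν R) (h' : HasDecay ω ν R') : HasDecay ω ν (R * R') :=
  ⟨ne_top_of_le_ne_top (ENNReal.mul_ne_top h.1 h'.1) (schurNorm_entryEnorm_mul_le hω),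
    ne_top_of_le_ne_top (ENNReal.mul_ne_top hc (ENNReal.add_ne_top.2
      ⟨ENNReal.mul_ne_top h.2 h'.1, ENNReal.mul_ne_top h.1 h'.2⟩))
      (entryNorm_entryEnorm_mul_le hν)⟩

lemma pow {c : ℝ≥0∞} (hc : c ≠ ⊤) (hω₁ : ∀ k, ω k k ≤ 1)
    (hω : ∀ k j l, ω k l ≤ ω k j * ω j l) (hν₁ : ∀ k, ν k k ≤ 1)
    (hν : ∀ k j l, ν k l ≤ c * (ν k j * ω j l + ω k j * ν j l))
    (h : HasDecay ω ν R) (n : ℕ) : HasDecay ω ν (R ^ n) := by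
  induction n with
  | zero => simpa using one hω₁ hν₁
  | succ n ih => exact pow_succ R n ▸ ih.mul hc hω hν h

lemma tsum {κ : Type*} {f : κ → lp (fun _ : ι => H) 2 →L[ℂ] lp (fun _ : ι => H) 2}
    (hf : Summable f) (h₁ : ∑' n, schurNorm ω (entryEnorm (f n)) ≠ ⊤)
    (h₂ : ∑' n, entryNorm ν (entryEnorm (f n)) ≠ ⊤) : HasDecay ω ν (∑' n, f n) :=
  ⟨ne_top_of_le_ne_top h₁ ((schurNorm_mono fun k l =>
      mul_le_mul_left (entryEnorm_tsum_le hf k l) _).trans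
        (schurNorm_tsum_le fun n => entryEnorm (f n))),
    ne_top_of_le_ne_top h₂ ((entryNorm_mono fun k l =>
      mul_le_mul_left (entryEnorm_tsum_le hf k l) _).trans
        (entryNorm_tsum_le fun n => entryEnorm (f n)))⟩

lemma sum {κ : Type*} (s : Finset κ)
    {f : κ → lp (fun _ : ι => H) 2 →L[ℂ] lp (fun _ : ι => H) 2}
    (h : ∀ n ∈ s, HasDecay ω ν (f n)) : HasDecay ω ν (∑ n ∈ s, f n) := by
  rw [← Finset.tsum_subtype s f]
  refine tsum Summable.of_finite ?_ ?_
  · rw [tsum_fintype]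
    exact ENNReal.sum_ne_top.2 fun n _ => (h n n.2).1
  · rw [tsum_fintype]
    exact ENNReal.sum_ne_top.2 fun n _ => (h n n.2).2

lemma smul (c : ℂ) (h : HasDecay ω ν R) : HasDecay ω ν (c • R) := by
  have hc : entryEnorm (c • R) = fun k l => ‖c‖ₑ * entryEnorm R k l := by
    funext k l
    exact entryEnorm_smul R c k l
  rw [HasDecay, hc, schurNorm_smul, entryNorm_smul]
  exact ⟨ENNReal.mul_ne_top enorm_ne_top h.1, ENNReal.mul_ne_top enorm_ne_top h.2⟩

lemma sub (h : HasDecay ω ν R) (h' : HasDecay ω ν R') : HasDecay ω ν (R - R') := by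
  have hs : R - R' = ∑ i : Bool, bif i then R else (-1 : ℂ) • R' := by
    simp [sub_eq_add_neg]
  rw [hs]
  refine sum _ fun i _ => ?_
  cases i
  · exact h'.smul (-1)
  · exact h

lemma adjoint [CompleteSpace H] (hω : ∀ k l, ω k l = ω l k) (hν : ∀ k l, ν k l = ν l k)
    (h : HasDecay ω ν R) : HasDecay ω ν (ContinuousLinearMap.adjoint R) := by
  rw [HasDecay, entryEnorm_adjoint, schurNorm_swap hω, entryNorm_swap hν]
  exact h

lemma mono_weight {ω' ν' : ι → ι → ℝ≥0∞} {C : ℝ≥0∞} (hC : C ≠ ⊤)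
    (hω : ∀ k l, ω' k l ≤ C * ω k l) (hν : ∀ k l, ν' k l ≤ C * ν k l)
    (h : HasDecay ω ν R) : HasDecay ω' ν' R := by
  refine ⟨ne_top_of_le_ne_top (ENNReal.mul_ne_top hC h.1) ?_,
    ne_top_of_le_ne_top (ENNReal.mul_ne_top hC h.2) ?_⟩
  · rw [← schurNorm_smul]
    exact schurNorm_mono fun k l => (mul_le_mul_right (hω k l) _).trans_eq (by ring)
  · rw [← entryNorm_smul]
    exact entryNorm_mono fun k l => (mul_le_mul_right (hν k l) _).trans_eq (by ring)

/-- The Neumann series of a decaying contraction with small weighted Schur norm is decaying. -/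
lemma tsum_pow {c : ℝ≥0∞} (hc : c ≠ ⊤) (hω₁ : ∀ k, ω k k ≤ 1)
    (hω : ∀ k j l, ω k l ≤ ω k j * ω j l) (hν₁ : ∀ k, ν k k ≤ 1)
    (hν : ∀ k j l, ν k l ≤ c * (ν k j * ω j l + ω k j * ν j l))
    (h : HasDecay ω ν R) (hR : schurNorm ω (entryEnorm R) ≤ 4⁻¹)
    (hcR : c * schurNorm ω (entryEnorm R) ≤ 4⁻¹) (hf : Summable fun n : ℕ => R ^ n) :
    HasDecay ω ν (∑' n : ℕ, R ^ n) := by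
  refine tsum hf ?_ ?_
  · refine ne_top_of_le_ne_top ?_
      (ENNReal.tsum_le_tsum fun n => schurNorm_entryEnorm_pow_le hω₁ hω n)
    refine (tsum_geometric_lt_top.2 (hR.trans_lt ?_)).ne
    exact ENNReal.inv_lt_one.2 (by norm_num)
  · refine ne_top_of_le_ne_top ?_
      (ENNReal.tsum_le_tsum fun n => entryNorm_entryEnorm_pow_le hω₁ hω hν₁ hν hR hcR n)
    rw [ENNReal.tsum_mul_left]
    refine ENNReal.mul_ne_top (ENNReal.add_ne_top.2 ⟨ENNReal.one_ne_top,
      ENNReal.mul_ne_top (by norm_num) (ENNReal.mul_ne_top hc h.2)⟩) ?_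
    exact (tsum_geometric_lt_top.2 (ENNReal.inv_lt_one.2 (by norm_num))).ne

end HasDecay

end WeightedOperators

section NeumannSeries

variable {E : Type*} [NormedAddCommGroup E] [InnerProductSpace ℂ E] [CompleteSpace E]

lemma exists_norm_one_sub_smul_adjoint_mul_lt_one (T S : E →L[ℂ] E) (hST : S * T = 1) :
    ∃ c : ℂ, ‖1 - c • (ContinuousLinearMap.adjoint T * T)‖ < 1 := by
  set M : ℝ := ‖T‖ ^ 2 + 1 with hM
  set m : ℝ := ‖S‖ ^ 2 + 1 with hm
  have hM1 : 1 ≤ M := by rw [hM]; nlinarith [sq_nonneg ‖T‖]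
  have hm1 : 1 ≤ m := by rw [hm]; nlinarith [sq_nonneg ‖S‖]
  have hlt : 1 / (M * m) ≤ 1 := by
    rw [div_le_one (by positivity)]
    nlinarith
  have hpos : 0 < 1 / (M * m) := by positivity
  refine ⟨((1 / M : ℝ) : ℂ), lt_of_le_of_lt (b := Real.sqrt (1 - 1 / (M * m))) ?_ ?_⟩
  · refine ContinuousLinearMap.opNorm_le_bound _ (Real.sqrt_nonneg _) fun x => ?_
    have hx : ‖x‖ ^ 2 ≤ m * ‖T x‖ ^ 2 := by
      have h₁ : S (T x) = x := congrArg (fun L : E →L[ℂ] E => L x) hST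
      have h₂ : ‖x‖ ≤ ‖S‖ * ‖T x‖ := by
        simpa [h₁] using S.le_opNorm (T x)
      calc ‖x‖ ^ 2 ≤ (‖S‖ * ‖T x‖) ^ 2 := by gcongr
        _ ≤ m * ‖T x‖ ^ 2 := by rw [hm]; nlinarith [sq_nonneg ‖T x‖]
    have hadj : ‖ContinuousLinearMap.adjoint T (T x)‖ ^ 2 ≤ M * ‖T x‖ ^ 2 := by
      have h₂ : ‖ContinuousLinearMap.adjoint T (T x)‖ ≤ ‖T‖ * ‖T x‖ := by
        simpa using (ContinuousLinearMap.adjoint T).le_opNorm (T x)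
      calc ‖ContinuousLinearMap.adjoint T (T x)‖ ^ 2 ≤ (‖T‖ * ‖T x‖) ^ 2 := by gcongr
        _ ≤ M * ‖T x‖ ^ 2 := by rw [hM]; nlinarith [sq_nonneg ‖T x‖]
    have hinner : RCLike.re (inner ℂ x (ContinuousLinearMap.adjoint T (T x))) = ‖T x‖ ^ 2 := by
      rw [ContinuousLinearMap.adjoint_inner_right, inner_self_eq_norm_sq]
    have hexp : ‖x - ((1 / M : ℝ) : ℂ) • ContinuousLinearMap.adjoint T (T x)‖ ^ 2
        = ‖x‖ ^ 2 - 2 * ((1 / M) * ‖T x‖ ^ 2)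
          + (1 / M) ^ 2 * ‖ContinuousLinearMap.adjoint T (T x)‖ ^ 2 := by
      have hre : RCLike.re (inner ℂ x (((1 / M : ℝ) : ℂ) •
          ContinuousLinearMap.adjoint T (T x))) = (1 / M) * ‖T x‖ ^ 2 := by
        rw [inner_smul_right, ← hinner]
        exact RCLike.re_ofReal_mul (K := ℂ) _ _
      rw [norm_sub_sq (𝕜 := ℂ), hre, norm_smul, mul_pow, Complex.norm_real, Real.norm_eq_abs,
        sq_abs]
    have hfin : ‖x - ((1 / M : ℝ) : ℂ) • ContinuousLinearMap.adjoint T (T x)‖ ^ 2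
        ≤ (1 - 1 / (M * m)) * ‖x‖ ^ 2 := by
      rw [hexp]
      have h₁ : (1 / M) ^ 2 * ‖ContinuousLinearMap.adjoint T (T x)‖ ^ 2
          ≤ (1 / M) * ‖T x‖ ^ 2 := by
        calc (1 / M) ^ 2 * ‖ContinuousLinearMap.adjoint T (T x)‖ ^ 2
            ≤ (1 / M) ^ 2 * (M * ‖T x‖ ^ 2) := by gcongr
          _ = _ := by field_simp
      have h₂ : 1 / (M * m) * ‖x‖ ^ 2 ≤ (1 / M) * ‖T x‖ ^ 2 := by
        calc 1 / (M * m) * ‖x‖ ^ 2 ≤ 1 / (M * m) * (m * ‖T x‖ ^ 2) := by gcongr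
          _ = _ := by field_simp
      linarith
    calc ‖(1 - ((1 / M : ℝ) : ℂ) • (ContinuousLinearMap.adjoint T * T)) x‖
        = ‖x - ((1 / M : ℝ) : ℂ) • ContinuousLinearMap.adjoint T (T x)‖ := rfl
      _ ≤ Real.sqrt ((1 - 1 / (M * m)) * ‖x‖ ^ 2) := Real.le_sqrt_of_sq_le hfin
      _ = _ := by rw [Real.sqrt_mul (by linarith), Real.sqrt_sq (norm_nonneg _)]
  · rw [Real.sqrt_lt' one_pos]
    linarith

/-- The inverse of `T` in terms of a Neumann series in a power of `1 - c T* T`. -/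
lemma inverse_eq_tsum_pow_mul {T S R : E →L[ℂ] E} {c : ℂ} (hTS : T * S = 1)
    (hR : R = 1 - c • (ContinuousLinearMap.adjoint T * T)) {n : ℕ} (hn : ‖R ^ n‖ < 1) :
    S = (∑' j : ℕ, (R ^ n) ^ j) * (∑ i ∈ Finset.range n, R ^ i) *
      (c • ContinuousLinearMap.adjoint T) := by
  have h₁ : (∑' j : ℕ, (R ^ n) ^ j) * (∑ i ∈ Finset.range n, R ^ i) * (1 - R) = 1 := by
    rw [mul_assoc, geom_sum_mul_neg, geom_series_mul_neg _ hn]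
  have h₂ : (1 - R) * S = c • ContinuousLinearMap.adjoint T := by
    rw [hR, sub_sub_cancel, smul_mul_assoc, mul_assoc, hTS, mul_one]
  rw [← h₂, ← mul_assoc, h₁, one_mul]

end NeumannSeries

section QuadraticRecursion

lemma exists_one_lt_pow_mul_lt_one (d : ℕ) {q : ℝ} (hq : q < 1) :
    ∃ θ : ℝ, 1 < θ ∧ θ ^ d * q < 1 := by
  have hc : Tendsto (fun θ : ℝ => θ ^ d * q) (nhdsWithin 1 (Set.Ioi 1)) (nhds (1 ^ d * q)) :=
    ((continuous_pow d).mul continuous_const).continuousAt.tendsto.mono_left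
      nhdsWithin_le_nhds
  have h₁ := hc.eventually_lt_const (u := 1) (by simpa using hq)
  obtain ⟨θ, h, hθ⟩ := (h₁.and self_mem_nhdsWithin).exists
  exact ⟨θ, hθ, h⟩

lemma tendsto_pow_two_pow_zero {t : ℝ} (h0 : 0 ≤ t) (h1 : t < 1) :
    Tendsto (fun n : ℕ => t ^ 2 ^ n) atTop (nhds 0) :=
  (tendsto_pow_atTop_nhds_zero_of_lt_one h0 h1).comp
    (tendsto_pow_atTop_atTop_of_one_lt (by norm_num))

/-- A quadratic recursion whose coefficients decay doubly exponentially eventually enters the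
unit interval. -/
lemma eventually_le_one_of_le_sq {x : ℕ → ℝ} {E lam : ℝ}
    (hl0 : 0 < lam) (hl1 : lam < 1)
    (h : ∀ n y, 1 ≤ y → x n ≤ y → x (n + 1) ≤ E * lam ^ 2 ^ n * y ^ 2) :
    ∀ᶠ n in atTop, x n ≤ 1 := by
  obtain ⟨μ, hμ0, hμ1, hμ⟩ : ∃ μ : ℝ, 0 < μ ∧ μ < 1 ∧ μ ^ 4 = lam := by
    refine ⟨Real.sqrt (Real.sqrt lam), by positivity, ?_, ?_⟩
    · rw [Real.sqrt_lt' one_pos, one_pow, Real.sqrt_lt' one_pos, one_pow]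
      exact hl1
    · rw [show 4 = 2 * 2 from rfl, pow_mul, Real.sq_sqrt (Real.sqrt_nonneg _),
        Real.sq_sqrt hl0.le]
  have hev : ∀ᶠ n : ℕ in atTop, E * (μ ^ 2) ^ 2 ^ n ≤ 1 := by
    have ht : Tendsto (fun n : ℕ => E * (μ ^ 2) ^ 2 ^ n) atTop (nhds (E * 0)) :=
      (tendsto_pow_two_pow_zero (by positivity) (by nlinarith)).const_mul E
    exact (ht.eventually_lt_const (u := 1) (by simp)).mono fun n hn => hn.le
  obtain ⟨n₀, hn₀⟩ := eventually_atTop.1 hev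
  set Z : ℝ := max 1 (x n₀) / μ ^ n₀ with hZ
  have hZ0 : 0 < Z := by positivity
  have key : ∀ n ≥ n₀, x n ≤ max 1 ((Z * μ ^ n) ^ 2 ^ n) := by
    intro n hn
    induction n, hn using Nat.le_induction with
    | base =>
      have h₁ : Z * μ ^ n₀ = max 1 (x n₀) := by rw [hZ]; field_simp
      rw [h₁]
      refine le_max_of_le_right ((le_max_right 1 (x n₀)).trans ?_)
      exact le_self_pow₀ (le_max_left _ _) (by positivity)
    | succ n hn ih =>
      set b : ℝ := (Z * μ ^ n) ^ 2 ^ n with hb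
      have hb0 : 0 < b := by positivity
      have hl : lam ^ 2 ^ n = (μ ^ 2) ^ 2 ^ n * (μ ^ 2) ^ 2 ^ n := by
        rw [← mul_pow, ← hμ]; congr 1; ring
      have hm : (μ ^ 2) ^ 2 ^ n ≤ 1 := pow_le_one₀ (by positivity) (by nlinarith)
      have hm0 : 0 < (μ ^ 2) ^ 2 ^ n := by positivity
      have hy : max 1 b ^ 2 ≤ max 1 (b ^ 2) := by
        rcases le_total 1 b with hb1 | hb1
        · rw [max_eq_right hb1]; exact le_max_right _ _
        · rw [max_eq_left hb1, one_pow]; exact le_max_left _ _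
      have hnext : (Z * μ ^ (n + 1)) ^ 2 ^ (n + 1) = (μ ^ 2) ^ 2 ^ n * b ^ 2 := by
        rw [hb, show Z * μ ^ (n + 1) = μ * (Z * μ ^ n) by ring, mul_pow, pow_succ' 2 n,
          pow_mul, pow_mul' (Z * μ ^ n)]
      calc x (n + 1) ≤ E * lam ^ 2 ^ n * max 1 b ^ 2 := h n _ (le_max_left _ _) ih
        _ = (E * (μ ^ 2) ^ 2 ^ n) * ((μ ^ 2) ^ 2 ^ n * max 1 b ^ 2) := by rw [hl]; ring
        _ ≤ 1 * ((μ ^ 2) ^ 2 ^ n * max 1 (b ^ 2)) := by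
            gcongr
            exact hn₀ n hn
        _ = max ((μ ^ 2) ^ 2 ^ n * 1) ((μ ^ 2) ^ 2 ^ n * b ^ 2) := by
            rw [one_mul, mul_max_of_nonneg _ _ hm0.le]
        _ ≤ _ := by
            rw [hnext, mul_one]
            exact max_le_max hm le_rfl
  have hZev : ∀ᶠ n : ℕ in atTop, Z * μ ^ n ≤ 1 := by
    have ht : Tendsto (fun n : ℕ => Z * μ ^ n) atTop (nhds (Z * 0)) :=
      (tendsto_pow_atTop_nhds_zero_of_lt_one hμ0.le hμ1).const_mul Z
    exact (ht.eventually_lt_const (u := 1) (by simp)).mono fun n hn => hn.le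
  filter_upwards [hZev, eventually_ge_atTop n₀] with n hn hn'
  exact (key n hn').trans (max_le le_rfl (pow_le_one₀ (by positivity) hn))

/-- Interpolation between a weighted and an unweighted norm forces the unweighted norms of the
dyadic powers of a contraction to become small. -/
lemma exists_le_of_interpolation {x a : ℕ → ℝ} {q D K δ η : ℝ} (d : ℕ) (hx : ∀ n, 0 ≤ x n)
    (ha : ∀ n, 0 ≤ a n) (hq0 : 0 ≤ q) (hq1 : q < 1) (hD : 0 ≤ D) (hK : 0 ≤ K) (hδ : 0 < δ)
    (hη : 0 < η) (hxa : ∀ n, x (n + 1) ≤ D * (x n * a n))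
    (hax : ∀ n, ∀ τ : ℝ, 1 ≤ τ → a n ≤ K * τ ^ d * q ^ 2 ^ n + τ ^ (-δ) * x n) :
    ∃ n, a n ≤ η := by
  obtain ⟨θ, hθ1, hθq⟩ := exists_one_lt_pow_mul_lt_one d hq1
  have hθ0 : 0 < θ := one_pos.trans hθ1
  set lam : ℝ := max (θ ^ d * q) (θ ^ (-δ)) with hlam
  have hl0 : 0 < lam := lt_max_of_lt_right (Real.rpow_pos_of_pos hθ0 _)
  have hl1 : lam < 1 := max_lt hθq (Real.rpow_lt_one_of_one_lt_of_neg hθ1 (by linarith))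
  have ha' : ∀ n, a n ≤ lam ^ 2 ^ n * (K + x n) := by
    intro n
    have h₁ : (θ ^ d * q) ^ 2 ^ n ≤ lam ^ 2 ^ n :=
      pow_le_pow_left₀ (by positivity) (le_max_left _ _) _
    have h₂ : (θ ^ (-δ)) ^ 2 ^ n ≤ lam ^ 2 ^ n :=
      pow_le_pow_left₀ (by positivity) (le_max_right _ _) _
    calc a n ≤ K * (θ ^ 2 ^ n) ^ d * q ^ 2 ^ n + (θ ^ 2 ^ n) ^ (-δ) * x n :=
          hax n _ (one_le_pow₀ hθ1.le)
      _ = K * (θ ^ d * q) ^ 2 ^ n + (θ ^ (-δ)) ^ 2 ^ n * x n := by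
          have h₃ : (θ ^ 2 ^ n) ^ (-δ) = (θ ^ (-δ)) ^ 2 ^ n := by
            rw [← Real.rpow_natCast, ← Real.rpow_natCast, ← Real.rpow_mul hθ0.le,
              ← Real.rpow_mul hθ0.le, mul_comm]
          rw [h₃, mul_pow, ← pow_mul, ← pow_mul, mul_comm d]
          ring
      _ ≤ K * lam ^ 2 ^ n + lam ^ 2 ^ n * x n := by
          gcongr
          exact hx n
      _ = _ := by ring
  have hev : ∀ᶠ n in atTop, x n ≤ 1 := by
    refine eventually_le_one_of_le_sq (E := D * (K + 1)) hl0 hl1 ?_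
    intro n y hy hxy
    have hx0 := hx n
    have ha0 := ha n
    calc x (n + 1) ≤ D * (x n * a n) := hxa n
      _ ≤ D * (y * (lam ^ 2 ^ n * (K + x n))) := by
          gcongr
          exact ha' n
      _ ≤ D * (y * (lam ^ 2 ^ n * ((K + 1) * y))) := by
          gcongr
          nlinarith
      _ = _ := by ring
  have ht : Tendsto (fun n : ℕ => lam ^ 2 ^ n * (K + 1)) atTop (nhds (0 * (K + 1))) :=
    (tendsto_pow_two_pow_zero hl0.le hl1).mul_const _
  obtain ⟨n, hn, hn'⟩ := (hev.and (ht.eventually_lt_const (u := η) (by simpa using hη))).exists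
  refine ⟨n, (ha' n).trans (le_trans ?_ hn'.le)⟩
  gcongr

end QuadraticRecursion

section ConcaveWeights

variable {ρ : ℝ → ℝ}

lemma ConcaveOn.increment_le (hc : ConcaveOn ℝ (Set.Ici 0) ρ) {a b h : ℝ} (ha : 0 ≤ a)
    (hab : a ≤ b) (hh : 0 ≤ h) : ρ (b + h) - ρ b ≤ ρ (a + h) - ρ a := by
  rcases hh.eq_or_lt with rfl | hh
  · simp
  have hD : 0 < b - a + h := by linarith
  have ha' : a ∈ Set.Ici (0 : ℝ) := ha
  have hb' : b + h ∈ Set.Ici (0 : ℝ) := by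
    rw [Set.mem_Ici]; linarith
  have h₁ := hc.2 ha' hb' (show 0 ≤ (b - a) / (b - a + h) from div_nonneg (by linarith) hD.le)
    (show 0 ≤ h / (b - a + h) by positivity) (by field_simp)
  have h₂ := hc.2 ha' hb' (show 0 ≤ h / (b - a + h) by positivity)
    (show 0 ≤ (b - a) / (b - a + h) from div_nonneg (by linarith) hD.le) (by field_simp; ring)
  have e₁ : ((b - a) / (b - a + h)) • a + (h / (b - a + h)) • (b + h) = a + h := by
    simp only [smul_eq_mul]; field_simp; ring
  have e₂ : (h / (b - a + h)) • a + ((b - a) / (b - a + h)) • (b + h) = b := by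
    simp only [smul_eq_mul]; field_simp; ring
  rw [e₁] at h₁
  rw [e₂] at h₂
  have e₃ : (b - a) / (b - a + h) = 1 - h / (b - a + h) := by field_simp; ring
  simp only [smul_eq_mul, e₃] at h₁ h₂
  linarith

lemma ConcaveOn.monotoneOn_of_nonneg (hc : ConcaveOn ℝ (Set.Ici 0) ρ)
    (hρ : ∀ t ∈ Set.Ici (0 : ℝ), 0 ≤ ρ t) : MonotoneOn ρ (Set.Ici 0) := by
  intro a ha b _ hab
  by_contra! hlt
  have ha0 : 0 ≤ a := ha
  have hh : 0 ≤ b - a := sub_nonneg.2 hab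
  have key : ∀ n : ℕ, ρ (a + n * (b - a)) ≤ ρ a + n * (ρ b - ρ a) := by
    intro n
    induction n with
    | zero => simp
    | succ n ih =>
      have h := hc.increment_le ha0 (b := a + n * (b - a)) (by nlinarith [n.cast_nonneg (α := ℝ)])
        hh
      have e : a + ((n + 1 : ℕ) : ℝ) * (b - a) = a + n * (b - a) + (b - a) := by
        push_cast; ring
      rw [e]
      push_cast
      rw [add_sub_cancel] at h
      linarith
  obtain ⟨n, hn⟩ := exists_nat_gt (ρ a / (ρ a - ρ b))
  rw [div_lt_iff₀ (by linarith)] at hn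
  have hpos := hρ (a + n * (b - a)) (by
    rw [Set.mem_Ici]; nlinarith [n.cast_nonneg (α := ℝ)])
  linarith [key n]

lemma ConcaveOn.add_sub_le_mul_div (hc : ConcaveOn ℝ (Set.Ici 0) ρ) (h0 : ρ 0 = 0) {t τ : ℝ}
    (ht : 0 ≤ t) (hτ : 0 < τ) : ρ (t + τ) - ρ τ ≤ t * (ρ τ / τ) := by
  have htτ : 0 < t + τ := by linarith
  have h := hc.2 (Set.mem_Ici.2 le_rfl) (Set.mem_Ici.2 htτ.le)
    (show 0 ≤ t / (t + τ) by positivity) (show 0 ≤ τ / (t + τ) by positivity) (by field_simp)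
  have e : (t / (t + τ)) • (0 : ℝ) + (τ / (t + τ)) • (t + τ) = τ := by
    simp only [smul_eq_mul]; field_simp; ring
  rw [e] at h
  simp only [smul_eq_mul, h0, mul_zero, zero_add] at h
  rw [div_mul_eq_mul_div, div_le_iff₀ htτ] at h
  rw [← mul_div_assoc, le_div_iff₀ hτ]
  linarith

/-- Shifting an unbounded sublinear concave function makes the associated weight almost constant
near the origin and negligible with respect to the original weight far away. -/
lemma ConcaveOn.exists_exp_shift_le (hc : ConcaveOn ℝ (Set.Ici 0) ρ) (h0 : ρ 0 = 0)
    (hunb : ∀ L, ∃ M, 0 ≤ M ∧ L ≤ ρ M)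
    (hsub : ∀ ε > 0, ∃ τ, 0 < τ ∧ ρ τ ≤ ε * τ) {η : ℝ} (hη : 0 < η) :
    ∃ τ, 0 < τ ∧ ∀ t, 0 ≤ t → Real.exp (ρ (t + τ) - ρ τ) ≤ 2 + η * Real.exp (ρ t) := by
  obtain ⟨M, hM0, hM⟩ := hunb (Real.log (2 / η))
  have hlog : 0 < Real.log 2 := Real.log_pos (by norm_num)
  obtain ⟨τ, hτ, hτ'⟩ := hsub (Real.log 2 / (M + 1)) (by positivity)
  have hquot : ρ τ / τ ≤ Real.log 2 / (M + 1) := by rwa [div_le_iff₀ hτ]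
  have hnear : ∀ t, 0 ≤ t → t ≤ M → ρ (t + τ) - ρ τ ≤ Real.log 2 := by
    intro t ht htM
    calc ρ (t + τ) - ρ τ ≤ t * (ρ τ / τ) := hc.add_sub_le_mul_div h0 ht hτ
      _ ≤ t * (Real.log 2 / (M + 1)) := by gcongr
      _ ≤ (M + 1) * (Real.log 2 / (M + 1)) := by gcongr; linarith
      _ = Real.log 2 := by field_simp
  refine ⟨τ, hτ, fun t ht => ?_⟩
  have hpos : 0 < η * Real.exp (ρ t) := by positivity
  rcases le_total t M with htM | hMt
  · have h := Real.exp_le_exp.2 (hnear t ht htM)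
    rw [Real.exp_log (by norm_num)] at h
    linarith
  · have h₁ := hc.increment_le hM0 hMt hτ.le
    have h₂ := hnear M hM0 le_rfl
    have hle : ρ (t + τ) - ρ τ ≤ Real.log η + ρ t := by
      rw [Real.log_div (by norm_num) hη.ne'] at hM
      linarith
    have h := Real.exp_le_exp.2 hle
    rw [Real.exp_add, Real.exp_log hη] at h
    linarith

/-- The properties of a weight that make the weighted Schur class a Banach algebra. -/
structure IsAlgebraWeight {d : ℕ} (w : Euc d → ℝ) : Prop where
  pos : ∀ x, 0 < w x
  map_zero : w 0 = 1
  map_neg : ∀ x, w (-x) = w x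
  map_add_le : ∀ x y, w (x + y) ≤ w x * w y

lemma IsNormOn.map_neg {d : ℕ} {nrm : Euc d → ℝ} (h : IsNormOn nrm) (x : Euc d) :
    nrm (-x) = nrm x := by
  simpa using h.2.2.1 (-1) x

lemma isAlgebraWeight_exp_shift {d : ℕ} {nrm : Euc d → ℝ} (hn : IsNormOn nrm)
    (hc : ConcaveOn ℝ (Set.Ici 0) ρ) (hρ : ∀ t ∈ Set.Ici (0 : ℝ), 0 ≤ ρ t) {τ : ℝ} (hτ : 0 ≤ τ) :
    IsAlgebraWeight fun x : Euc d => Real.exp (ρ (nrm x + τ) - ρ τ) where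
  pos x := Real.exp_pos _
  map_zero := by
    simp [(hn.2.1 0).2 rfl]
  map_neg x := by
    simp only [hn.map_neg x]
  map_add_le x y := by
    rw [← Real.exp_add, Real.exp_le_exp]
    have hx := hn.1 x
    have hy := hn.1 y
    have hxy := hn.1 (x + y)
    have h₁ : ρ (nrm (x + y) + τ) ≤ ρ (nrm y + τ + nrm x) := by
      refine hc.monotoneOn_of_nonneg hρ ?_ ?_ ?_
      · rw [Set.mem_Ici]; linarith
      · rw [Set.mem_Ici]; linarith
      · linarith [hn.2.2.2 x y]
    have h₂ := hc.increment_le hτ (b := nrm y + τ) (by linarith) hx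
    rw [add_comm τ] at h₂
    linarith

lemma Admissible.isAlgebraWeight {d : ℕ} {u : Euc d → ℝ} (hu : Admissible u) :
    IsAlgebraWeight u := by
  obtain ⟨⟨ρ, nrm, hn, -, hc, h0, hρ, hu⟩, -⟩ := hu
  have h := isAlgebraWeight_exp_shift hn hc hρ le_rfl
  simp only [h0, add_zero, sub_zero] at h
  rwa [funext hu]

lemma Admissible.exists_sublinear {d : ℕ} {u : Euc d → ℝ} {nrm : Euc d → ℝ}
    (hu : Admissible u) (hn : IsNormOn nrm) (hexp : ∀ x, u x = Real.exp (ρ (nrm x)))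
    {z : Euc d} (hz : z ≠ 0) {ε : ℝ} (hε : 0 < ε) : ∃ τ, 0 < τ ∧ ρ τ ≤ ε * τ := by
  have hz0 : 0 < nrm z := (hn.1 z).lt_of_ne fun h => hz ((hn.2.1 z).1 h.symm)
  have hlim := (hu.2 z).eventually_lt_const
    (u := Real.exp (ε * nrm z)) (Real.one_lt_exp_iff.2 (by positivity))
  obtain ⟨n, hn1, hn2⟩ := (hlim.and (eventually_gt_atTop 0)).exists
  have hnpos : (0 : ℝ) < n := by exact_mod_cast hn2
  refine ⟨n * nrm z, by positivity, ?_⟩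
  rw [hexp, hn.2.2.1, abs_of_pos hnpos, ← Real.exp_mul, Real.exp_lt_exp, mul_one_div,
    div_lt_iff₀ hnpos] at hn1
  linarith

/-- An admissible weight of polynomial growth has equivalent algebra weights that are bounded by
a fixed constant up to an arbitrarily small multiple of the original weight. -/
lemma Admissible.exists_equivalent_weight {d : ℕ} {u : Euc d → ℝ} (hu : Admissible u) {δ : ℝ}
    (hδ : 0 < δ) (hgrowth : ∀ x : Euc d, (1 + ‖x‖) ^ δ ≤ u x) {η : ℝ} (hη : 0 < η) :
    ∃ (w : Euc d → ℝ) (C : ℝ), IsAlgebraWeight w ∧ (∀ x, w x ≤ u x) ∧ (∀ x, u x ≤ C * w x) ∧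
      ∀ x, w x ≤ 2 + η * u x := by
  rcases subsingleton_or_nontrivial (Euc d) with hd | hd
  · refine ⟨u, 1, hu.isAlgebraWeight, fun x => le_rfl, fun x => (one_mul _).ge, fun x => ?_⟩
    have h₁ : u x = 1 := by rw [Subsingleton.elim x 0, hu.isAlgebraWeight.map_zero]
    rw [h₁]
    linarith
  obtain ⟨z, hz⟩ := exists_ne (0 : Euc d)
  obtain ⟨⟨ρ, nrm, hn, -, hc, h0, hρ, hexp⟩, -⟩ := id hu
  have hunb : ∀ L, ∃ M, 0 ≤ M ∧ L ≤ ρ M := by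
    intro L
    have hz0 : 0 < ‖z‖ := norm_pos_iff.2 hz
    have ht : Tendsto (fun n : ℕ => (1 + n * ‖z‖) ^ δ) atTop atTop :=
      (tendsto_rpow_atTop hδ).comp (tendsto_atTop_add_const_left _ _
        (tendsto_natCast_atTop_atTop.atTop_mul_const hz0))
    obtain ⟨n, hn'⟩ := (ht.eventually_ge_atTop (Real.exp L)).exists
    refine ⟨nrm ((n : ℝ) • z), hn.1 _, ?_⟩
    rw [← Real.exp_le_exp, ← hexp]
    refine hn'.trans (le_trans (le_of_eq ?_) (hgrowth _))
    rw [norm_smul, Real.norm_natCast]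
  obtain ⟨τ, hτ, hle⟩ := hc.exists_exp_shift_le h0 hunb
    (fun ε hε => hu.exists_sublinear hn hexp hz hε) hη
  refine ⟨fun x => Real.exp (ρ (nrm x + τ) - ρ τ), Real.exp (ρ τ),
    isAlgebraWeight_exp_shift hn hc hρ hτ.le, fun x => ?_, fun x => ?_, fun x => ?_⟩
  · have h := hc.increment_le le_rfl hτ.le (hn.1 x)
    rw [hexp, Real.exp_le_exp, add_comm]
    simpa [h0] using h
  · rw [← Real.exp_add, hexp, Real.exp_le_exp, add_sub_cancel]
    have hx := hn.1 x
    refine hc.monotoneOn_of_nonneg hρ (Set.mem_Ici.2 hx) (Set.mem_Ici.2 ?_) ?_ <;> linarith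
  · rw [hexp]
    exact hle _ (hn.1 x)

end ConcaveWeights

section Counting

lemma RelSep.exists_encard_le {d : ℕ} {X : Set (Euc d)} (hX : RelSep X) :
    ∃ K : ℝ, 0 ≤ K ∧ ∀ (k : Euc d) (τ : ℝ), 1 ≤ τ →
      (({l : X | ‖k - l‖ ≤ τ}.encard : ℕ∞) : ℝ≥0∞) ≤ ENNReal.ofReal (K * τ ^ d) := by
  classical
  obtain ⟨N, hN⟩ := hX
  refine ⟨N * 4 ^ d, by positivity, fun k τ hτ => ?_⟩
  set box : Finset (Fin d → ℤ) := Fintype.piFinset fun _ => Finset.Icc ⌊-τ⌋ ⌊τ⌋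
  set cube : (Fin d → ℤ) → Set (Euc d) := fun z =>
    X ∩ {y | ∀ j, (k + WithLp.toLp 2 fun j => (z j : ℝ) : Euc d) j ≤ y j ∧
      y j ≤ (k + WithLp.toLp 2 fun j => (z j : ℝ) : Euc d) j + 1}
  have hsub : ((↑) : X → Euc d) '' {l : X | ‖k - l‖ ≤ τ} ⊆ ⋃ z ∈ box, cube z := by
    rintro _ ⟨l, hl, rfl⟩
    have hcoord : ∀ j, |k j - (l : Euc d) j| ≤ τ := fun j => by
      have h := PiLp.norm_apply_le (k - (l : Euc d)) j
      rw [PiLp.sub_apply, Real.norm_eq_abs] at h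
      exact h.trans hl
    refine Set.mem_iUnion₂.2 ⟨fun j => ⌊(l : Euc d) j - k j⌋, ?_, l.2, fun j => ?_⟩
    · refine Fintype.mem_piFinset.2 fun j => Finset.mem_Icc.2 ⟨Int.floor_mono ?_,
        Int.floor_mono ?_⟩
      · linarith [(abs_le.1 (hcoord j)).2]
      · linarith [(abs_le.1 (hcoord j)).1]
    · simp only [PiLp.add_apply]
      constructor
      · linarith [Int.floor_le ((l : Euc d) j - k j)]
      · linarith [(Int.lt_floor_add_one ((l : Euc d) j - k j)).le]
  have hfin : (⋃ z ∈ box, cube z).Finite :=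
    box.finite_toSet.biUnion fun z _ => (hN _).1
  have hcard : (⋃ z ∈ box, cube z).ncard ≤ box.card * N :=
    (Finset.set_ncard_biUnion_le box cube).trans
      (Finset.sum_le_card_nsmul _ _ _ fun z _ => (hN _).2)
  have hbox : (box.card : ℝ) ≤ (4 * τ) ^ d := by
    rw [Fintype.card_piFinset_const, Int.card_Icc, Nat.cast_pow]
    have h₁ : ⌊-τ⌋ ≤ ⌊τ⌋ + 1 := (Int.floor_mono (by linarith)).trans (by linarith)
    have h₂ : (((⌊τ⌋ + 1 - ⌊-τ⌋).toNat : ℕ) : ℝ) = ⌊τ⌋ + 1 - ⌊-τ⌋ := by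
      have h₃ : (((⌊τ⌋ + 1 - ⌊-τ⌋).toNat : ℕ) : ℤ) = ⌊τ⌋ + 1 - ⌊-τ⌋ :=
        Int.toNat_of_nonneg (by linarith)
      exact_mod_cast h₃
    gcongr
    · rw [h₂]
      linarith [Int.floor_le τ, Int.lt_floor_add_one (-τ)]
  have henc : {l : X | ‖k - l‖ ≤ τ}.encard ≤ ((box.card * N : ℕ) : ℕ∞) := by
    rw [← Subtype.val_injective.injOn.encard_image]
    refine (Set.encard_le_encard hsub).trans ?_
    rw [← hfin.cast_ncard_eq]
    exact_mod_cast hcard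
  calc (({l : X | ‖k - l‖ ≤ τ}.encard : ℕ∞) : ℝ≥0∞)
      ≤ (((box.card * N : ℕ) : ℕ∞) : ℝ≥0∞) := by exact_mod_cast henc
    _ = ENNReal.ofReal ((box.card * N : ℕ) : ℝ) := by simp
    _ ≤ ENNReal.ofReal (N * 4 ^ d * τ ^ d) := by
        refine ENNReal.ofReal_le_ofReal ?_
        push_cast
        calc (box.card : ℝ) * N ≤ (4 * τ) ^ d * N := by gcongr
          _ = _ := by rw [mul_pow]; ring

end Counting

section WeightKernels

variable {d : ℕ} {X : Set (Euc d)} {w : Euc d → ℝ}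

/-- The matrix of weights `w (k - l)` for `k, l ∈ X`. -/
def weightKernel (X : Set (Euc d)) (w : Euc d → ℝ) (k l : X) : ℝ≥0∞ :=
  ENNReal.ofReal (w (k - l))

lemma one_add_norm_add_rpow_le {s : ℝ} (hs : 0 ≤ s) (x y : Euc d) :
    (1 + ‖x + y‖) ^ s ≤ 2 ^ s * ((1 + ‖x‖) ^ s + (1 + ‖y‖) ^ s) := by
  have hx : 0 ≤ (1 + ‖x‖) ^ s := by positivity
  have hy : 0 ≤ (1 + ‖y‖) ^ s := by positivity
  have h := norm_add_le x y
  rcases le_total ‖x‖ ‖y‖ with hxy | hxy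
  · calc (1 + ‖x + y‖) ^ s ≤ (2 * (1 + ‖y‖)) ^ s := by gcongr; linarith
      _ = 2 ^ s * (1 + ‖y‖) ^ s := Real.mul_rpow (by norm_num) (by positivity)
      _ ≤ _ := by gcongr; linarith
  · calc (1 + ‖x + y‖) ^ s ≤ (2 * (1 + ‖x‖)) ^ s := by gcongr; linarith
      _ = 2 ^ s * (1 + ‖x‖) ^ s := Real.mul_rpow (by norm_num) (by positivity)
      _ ≤ _ := by gcongr; linarith

lemma isAlgebraWeight_one_add_norm_rpow {s : ℝ} (hs : 0 ≤ s) :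
    IsAlgebraWeight fun x : Euc d => (1 + ‖x‖) ^ s where
  pos x := by positivity
  map_zero := by simp
  map_neg x := by simp
  map_add_le x y := by
    rw [← Real.mul_rpow (by positivity) (by positivity)]
    have h := norm_add_le x y
    gcongr
    nlinarith [norm_nonneg x, norm_nonneg y]

lemma weightKernel_one_add_norm_le {s : ℝ} (hs : 0 ≤ s) (k j l : X) :
    weightKernel X (fun x => (1 + ‖x‖) ^ s) k l ≤
      ENNReal.ofReal (2 ^ s) * (weightKernel X (fun x => (1 + ‖x‖) ^ s) k j
        + weightKernel X (fun x => (1 + ‖x‖) ^ s) j l) := by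
  simp only [weightKernel]
  rw [← ENNReal.ofReal_add (by positivity) (by positivity), ← ENNReal.ofReal_mul (by positivity)]
  refine ENNReal.ofReal_le_ofReal ?_
  have h := one_add_norm_add_rpow_le hs ((k : Euc d) - (j : Euc d)) ((j : Euc d) - (l : Euc d))
  rwa [sub_add_sub_cancel] at h

namespace IsAlgebraWeight

lemma weightKernel_self_le (hw : IsAlgebraWeight w) (k : X) : weightKernel X w k k ≤ 1 := by
  simp [weightKernel, hw.map_zero]

lemma weightKernel_symm (hw : IsAlgebraWeight w) (k l : X) :
    weightKernel X w k l = weightKernel X w l k := by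
  rw [weightKernel, weightKernel, ← hw.map_neg, neg_sub]

lemma weightKernel_le_mul (hw : IsAlgebraWeight w) (k j l : X) :
    weightKernel X w k l ≤ weightKernel X w k j * weightKernel X w j l := by
  simp only [weightKernel]
  rw [← ENNReal.ofReal_mul (hw.pos _).le]
  refine ENNReal.ofReal_le_ofReal ?_
  simpa using hw.map_add_le ((k : Euc d) - j) ((j : Euc d) - l)

lemma mul_rpow (hw : IsAlgebraWeight w) {s : ℝ} (hs : 0 ≤ s) :
    IsAlgebraWeight fun x : Euc d => w x * (1 + ‖x‖) ^ s where
  pos x := mul_pos (hw.pos x) (by positivity)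
  map_zero := by simp [hw.map_zero]
  map_neg x := by simp [hw.map_neg]
  map_add_le x y := by
    calc w (x + y) * (1 + ‖x + y‖) ^ s
        ≤ (w x * w y) * ((1 + ‖x‖) ^ s * (1 + ‖y‖) ^ s) :=
          mul_le_mul (hw.map_add_le x y) ((isAlgebraWeight_one_add_norm_rpow hs).map_add_le x y)
            (by positivity) (mul_pos (hw.pos x) (hw.pos y)).le
      _ = _ := by ring

lemma weightKernel_mul_rpow_le (hw : IsAlgebraWeight w) {s : ℝ} (hs : 0 ≤ s) (k j l : X) :
    weightKernel X (fun x => w x * (1 + ‖x‖) ^ s) k l ≤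
      ENNReal.ofReal (2 ^ s) *
        (weightKernel X (fun x => w x * (1 + ‖x‖) ^ s) k j * weightKernel X w j l
          + weightKernel X w k j * weightKernel X (fun x => w x * (1 + ‖x‖) ^ s) j l) := by
  have h₁ := hw.pos ((k : Euc d) - j)
  have h₂ := hw.pos ((j : Euc d) - l)
  simp only [weightKernel]
  rw [← ENNReal.ofReal_mul (by positivity), ← ENNReal.ofReal_mul h₁.le,
    ← ENNReal.ofReal_add (by positivity) (by positivity), ← ENNReal.ofReal_mul (by positivity)]
  refine ENNReal.ofReal_le_ofReal ?_
  have h₃ : w ((k : Euc d) - l) ≤ w ((k : Euc d) - j) * w ((j : Euc d) - l) := by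
    simpa using hw.map_add_le ((k : Euc d) - j) ((j : Euc d) - l)
  have h₄ := one_add_norm_add_rpow_le hs ((k : Euc d) - (j : Euc d)) ((j : Euc d) - (l : Euc d))
  rw [sub_add_sub_cancel] at h₄
  calc w ((k : Euc d) - l) * (1 + ‖(k : Euc d) - l‖) ^ s
      ≤ (w ((k : Euc d) - j) * w ((j : Euc d) - l)) *
          (2 ^ s * ((1 + ‖(k : Euc d) - j‖) ^ s + (1 + ‖(j : Euc d) - l‖) ^ s)) := by
        gcongr
    _ = _ := by ring

end IsAlgebraWeight

lemma summable_and_bddAbove_iff {κ κ' : Type*} {f : κ → κ' → ℝ} (hf : ∀ k l, 0 ≤ f k l) :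
    ((∀ k, Summable (f k)) ∧ BddAbove (Set.range fun k => ∑' l, f k l)) ↔
      ⨆ k, ∑' l, ENNReal.ofReal (f k l) ≠ ⊤ := by
  constructor
  · rintro ⟨hs, C, hC⟩
    refine ne_top_of_le_ne_top (ENNReal.ofReal_ne_top (r := C)) (iSup_le fun k => ?_)
    rw [← ENNReal.ofReal_tsum_of_nonneg (hf k) (hs k)]
    exact ENNReal.ofReal_le_ofReal (hC ⟨k, rfl⟩)
  · intro h
    have hk : ∀ k, ∑' l, ENNReal.ofReal (f k l) ≠ ⊤ := fun k =>
      ne_top_of_le_ne_top h (le_iSup (fun k => ∑' l, ENNReal.ofReal (f k l)) k)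
    have hs : ∀ k, Summable (f k) := fun k => by
      simpa [ENNReal.toReal_ofReal (hf k _)] using ENNReal.summable_toReal (hk k)
    refine ⟨hs, (⨆ k, ∑' l, ENNReal.ofReal (f k l)).toReal, ?_⟩
    rintro _ ⟨k, rfl⟩
    refine (ENNReal.ofReal_le_iff_le_toReal h).1 ?_
    rw [ENNReal.ofReal_tsum_of_nonneg (hf k) (hs k)]
    exact le_iSup (fun k => ∑' l, ENNReal.ofReal (f k l)) k

variable {H : Type*} [NormedAddCommGroup H] [InnerProductSpace ℂ H]

lemma ofReal_norm_mul_weight (A : X → X → (H →L[ℂ] H)) (k l : X) :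
    ENNReal.ofReal (‖A k l‖ * w ((k : Euc d) - l)) = ‖A k l‖ₑ * weightKernel X w k l := by
  rw [ENNReal.ofReal_mul (norm_nonneg _), ofReal_norm, weightKernel]

lemma memSchur1_iff (hw : ∀ x, 0 ≤ w x) (A : X → X → (H →L[ℂ] H)) :
    MemSchur1 w A ↔ schurNorm (weightKernel X w) (fun k l => ‖A k l‖ₑ) ≠ ⊤ := by
  have h₁ := summable_and_bddAbove_iff (f := fun k l : X => ‖A k l‖ * w ((k : Euc d) - l))
    fun k l => mul_nonneg (norm_nonneg _) (hw _)
  have h₂ := summable_and_bddAbove_iff (f := fun l k : X => ‖A k l‖ * w ((k : Euc d) - l))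
    fun k l => mul_nonneg (norm_nonneg _) (hw _)
  simp only [ofReal_norm_mul_weight] at h₁ h₂
  rw [MemSchur1, ← and_assoc, h₁, h₂, schurNorm]
  simp [rowNorm, Function.swap, max_eq_top]

lemma memJnu_iff (w : Euc d → ℝ) (A : X → X → (H →L[ℂ] H)) :
    MemJnu w A ↔ entryNorm (weightKernel X w) (fun k l => ‖A k l‖ₑ) ≠ ⊤ := by
  simp only [entryNorm, ← ofReal_norm_mul_weight]
  constructor
  · rintro ⟨C, hC⟩
    exact ne_top_of_le_ne_top (ENNReal.ofReal_ne_top (r := C))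
      (iSup₂_le fun k l => ENNReal.ofReal_le_ofReal (hC ⟨(k, l), rfl⟩))
  · intro h
    refine ⟨(⨆ k : X, ⨆ l : X, ENNReal.ofReal (‖A k l‖ * w ((k : Euc d) - l))).toReal, ?_⟩
    rintro _ ⟨⟨k, l⟩, rfl⟩
    exact (ENNReal.ofReal_le_iff_le_toReal h).1
      (le_iSup₂ (f := fun k l : X => ENNReal.ofReal (‖A k l‖ * w ((k : Euc d) - l))) k l)

/-- The unweighted Schur norm is controlled by the operator norm near the diagonal and by a
polynomially weighted Schur norm away from the diagonal. -/
lemma exists_schurNorm_one_le (hX : RelSep X) :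
    ∃ K : ℝ, 0 ≤ K ∧ ∀ (δ : ℝ) (Q : lp (fun _ : X => H) 2 →L[ℂ] lp (fun _ : X => H) 2) (τ : ℝ),
      0 ≤ δ → 1 ≤ τ → schurNorm (fun _ _ => 1) (entryEnorm Q) ≤
        ENNReal.ofReal (K * τ ^ d) * ‖Q‖ₑ
          + ENNReal.ofReal (τ ^ (-δ)) *
            schurNorm (weightKernel X fun x => (1 + ‖x‖) ^ δ) (entryEnorm Q) := by
  obtain ⟨K, hK, hcount⟩ := hX.exists_encard_le
  refine ⟨K, hK, fun δ Q τ hδ hτ => ?_⟩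
  have hτ0 : 0 < τ := one_pos.trans_le hτ
  have hpt : ∀ k l : X, entryEnorm Q k l * 1 ≤
      {l : X | ‖(k : Euc d) - l‖ ≤ τ}.indicator (fun _ => ‖Q‖ₑ) l
        + ENNReal.ofReal (τ ^ (-δ)) *
          (entryEnorm Q k l * weightKernel X (fun x => (1 + ‖x‖) ^ δ) k l) := by
    intro k l
    by_cases hkl : ‖(k : Euc d) - l‖ ≤ τ
    · rw [Set.indicator_of_mem (by exact hkl), mul_one]
      exact (entryEnorm_le Q k l).trans le_self_add
    · rw [Set.indicator_of_notMem (by exact hkl), zero_add, mul_left_comm, weightKernel,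
        ← ENNReal.ofReal_mul (by positivity)]
      refine mul_le_mul_right ?_ _
      rw [← ENNReal.ofReal_one]
      refine ENNReal.ofReal_le_ofReal ?_
      calc (1 : ℝ) = τ ^ (-δ) * τ ^ δ := by
            rw [← Real.rpow_add hτ0, neg_add_cancel, Real.rpow_zero]
        _ ≤ _ := by
            gcongr
            linarith [not_le.1 hkl]
  have hind : ∀ (k : X), ∑' l, {l : X | ‖(k : Euc d) - l‖ ≤ τ}.indicator (fun _ => ‖Q‖ₑ) l
      ≤ ENNReal.ofReal (K * τ ^ d) * ‖Q‖ₑ := by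
    intro k
    rw [← tsum_subtype, ENNReal.tsum_set_const]
    exact mul_le_mul_left (hcount k τ hτ) _
  refine schurNorm_le (fun k => ?_) fun l => ?_
  · refine (ENNReal.tsum_le_tsum fun l => hpt k l).trans ?_
    rw [ENNReal.tsum_add, ENNReal.tsum_mul_left]
    exact add_le_add (hind k) (mul_le_mul_right (tsum_row_le k) _)
  · refine (ENNReal.tsum_le_tsum fun k => hpt k l).trans ?_
    rw [ENNReal.tsum_add, ENNReal.tsum_mul_left]
    refine add_le_add (le_trans (le_of_eq ?_) (hind l)) (mul_le_mul_right (tsum_col_le l) _)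
    refine tsum_congr fun k => ?_
    simp only [Set.indicator, Set.mem_ofPred_eq, norm_sub_rev (l : Euc d)]

lemma exists_schurNorm_one_pow_le (hX : RelSep X)
    {R : lp (fun _ : X => H) 2 →L[ℂ] lp (fun _ : X => H) 2} (hR : ‖R‖ < 1) {δ η : ℝ} (hδ : 0 < δ)
    (hη : 0 < η)
    (hv : schurNorm (weightKernel X fun x => (1 + ‖x‖) ^ δ) (entryEnorm R) ≠ ⊤) :
    ∃ n : ℕ, schurNorm (fun _ _ => 1) (entryEnorm (R ^ 2 ^ n)) ≤ ENNReal.ofReal η := by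
  obtain ⟨K, hK, hint⟩ := exists_schurNorm_one_le (H := H) hX
  set v := weightKernel X fun x => (1 + ‖x‖) ^ δ with hv_def
  have hw := isAlgebraWeight_one_add_norm_rpow (d := d) hδ.le
  have hvfin : ∀ n, schurNorm v (entryEnorm (R ^ n)) ≠ ⊤ := fun n =>
    ne_top_of_le_ne_top (ENNReal.pow_ne_top hv)
      (schurNorm_entryEnorm_pow_le hw.weightKernel_self_le hw.weightKernel_le_mul n)
  have h1fin : ∀ n, schurNorm (fun _ _ => 1) (entryEnorm (R ^ n)) ≠ ⊤ := fun n =>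
    ne_top_of_le_ne_top (ENNReal.add_ne_top.2
      ⟨ENNReal.mul_ne_top ENNReal.ofReal_ne_top enorm_ne_top,
        ENNReal.mul_ne_top ENNReal.ofReal_ne_top (hvfin n)⟩) (hint δ (R ^ n) 1 hδ.le le_rfl)
  refine (exists_le_of_interpolation (d := d)
    (x := fun n => (schurNorm v (entryEnorm (R ^ 2 ^ n))).toReal)
    (a := fun n => (schurNorm (fun _ _ => 1) (entryEnorm (R ^ 2 ^ n))).toReal)
    (D := 2 * 2 ^ δ) (fun n => ENNReal.toReal_nonneg) (fun n => ENNReal.toReal_nonneg)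
    (norm_nonneg R) hR (by positivity) hK hδ hη (fun n => ?_)
    fun n τ hτ => ?_).imp fun n hn => (ENNReal.le_ofReal_iff_toReal_le (h1fin _) hη.le).2 hn
  · have h := schurNorm_entryEnorm_sq_le (R := R ^ 2 ^ n)
      (weightKernel_one_add_norm_le (X := X) hδ.le)
    rw [← pow_add, ← two_mul, ← pow_succ'] at h
    have h' := ENNReal.toReal_mono (ENNReal.mul_ne_top
      (ENNReal.mul_ne_top ENNReal.ofNat_ne_top ENNReal.ofReal_ne_top)
      (ENNReal.mul_ne_top (hvfin _) (h1fin _))) h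
    rw [ENNReal.toReal_mul, ENNReal.toReal_mul, ENNReal.toReal_mul,
      ENNReal.toReal_ofReal (by positivity), ENNReal.toReal_ofNat] at h'
    exact h'
  · have hτ0 : 0 < τ := one_pos.trans_le hτ
    have h := ENNReal.toReal_mono (ENNReal.add_ne_top.2
      ⟨ENNReal.mul_ne_top ENNReal.ofReal_ne_top enorm_ne_top,
        ENNReal.mul_ne_top ENNReal.ofReal_ne_top (hvfin _)⟩) (hint δ (R ^ 2 ^ n) τ hδ.le hτ)
    rw [ENNReal.toReal_add (ENNReal.mul_ne_top ENNReal.ofReal_ne_top enorm_ne_top)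
      (ENNReal.mul_ne_top ENNReal.ofReal_ne_top (hvfin _)), ENNReal.toReal_mul,
      ENNReal.toReal_mul, ENNReal.toReal_ofReal (by positivity),
      ENNReal.toReal_ofReal (by positivity), toReal_enorm] at h
    refine h.trans ?_
    gcongr
    exact norm_pow_le' R (by positivity)

lemma opEntry_eq_of_forall_apply_eq_tsum (A : X → X → (H →L[ℂ] H))
    (T : lp (fun _ : X => H) 2 →L[ℂ] lp (fun _ : X => H) 2)
    (hT : ∀ (f : lp (fun _ : X => H) 2) (k : X), T f k = ∑' l : X, A k l (f l)) (k l : X) :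
    opEntry T k l = A k l := by
  ext f
  rw [opEntry_apply, hT, tsum_eq_single l fun j hj => by rw [deltaSeq_ne hj, _root_.map_zero],
    deltaSeq_self]

/-- Inverse-closedness of the class of operators whose canonical matrix has weighted decay. -/
lemma HasDecay.of_inverse [CompleteSpace H] (hX : RelSep X) {u : Euc d → ℝ} (hu : Admissible u)
    {δ s : ℝ} (hδ : 0 < δ) (hs : 0 ≤ s) (hgrowth : ∀ x : Euc d, (1 + ‖x‖) ^ δ ≤ u x)
    {T S : lp (fun _ : X => H) 2 →L[ℂ] lp (fun _ : X => H) 2}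
    (hT : HasDecay (weightKernel X u) (weightKernel X fun x => u x * (1 + ‖x‖) ^ s) T)
    (hST : S * T = 1) (hTS : T * S = 1) :
    HasDecay (weightKernel X u) (weightKernel X fun x => u x * (1 + ‖x‖) ^ s) S := by
  have huw := hu.isAlgebraWeight
  have hus := huw.mul_rpow hs
  have hc : ENNReal.ofReal (2 ^ s) ≠ ⊤ := ENNReal.ofReal_ne_top
  have hmul := fun {A B : lp (fun _ : X => H) 2 →L[ℂ] lp (fun _ : X => H) 2} =>
    HasDecay.mul (R := A) (R' := B) hc (huw.weightKernel_le_mul (X := X))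
      (huw.weightKernel_mul_rpow_le hs)
  have hpow := fun {A : lp (fun _ : X => H) 2 →L[ℂ] lp (fun _ : X => H) 2} =>
    HasDecay.pow (R := A) hc (huw.weightKernel_self_le (X := X)) huw.weightKernel_le_mul
      hus.weightKernel_self_le (huw.weightKernel_mul_rpow_le hs)
  have hTadj := hT.adjoint huw.weightKernel_symm hus.weightKernel_symm
  obtain ⟨c, hc1⟩ := exists_norm_one_sub_smul_adjoint_mul_lt_one T S hST
  set R := 1 - c • (ContinuousLinearMap.adjoint T * T) with hRdef
  have hR : HasDecay (weightKernel X u) (weightKernel X fun x => u x * (1 + ‖x‖) ^ s) R :=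
    (HasDecay.one huw.weightKernel_self_le hus.weightKernel_self_le).sub
      ((hmul hTadj hT).smul c)
  have h2s : (1 : ℝ) ≤ 2 ^ s := Real.one_le_rpow (by norm_num) hs
  set ε : ℝ := 1 / (4 * 2 ^ s) with hε
  have hε0 : 0 < ε := by positivity
  obtain ⟨n, hn⟩ := exists_schurNorm_one_pow_le hX hc1 hδ (η := ε / 4) (by positivity)
    (ne_top_of_le_ne_top hR.1 (schurNorm_mono fun k l =>
      mul_le_mul_right (ENNReal.ofReal_le_ofReal (hgrowth _)) _))
  have hP := hpow hR (2 ^ n)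
  set P := R ^ 2 ^ n with hPdef
  set σ := (schurNorm (weightKernel X u) (entryEnorm P)).toReal with hσ
  have hσ0 : 0 ≤ σ := ENNReal.toReal_nonneg
  obtain ⟨w, C, hw, hwu, huC, hw2⟩ := hu.exists_equivalent_weight hδ hgrowth
    (η := ε / (2 * (σ + 1))) (by positivity)
  have hws := hw.mul_rpow hs
  have hPw : schurNorm (weightKernel X w) (entryEnorm P) ≤ ENNReal.ofReal ε := by
    calc schurNorm (weightKernel X w) (entryEnorm P)
        ≤ schurNorm (fun _ _ => 1) (fun k l => ENNReal.ofReal 2 * entryEnorm P k l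
            + ENNReal.ofReal (ε / (2 * (σ + 1))) * (entryEnorm P k l * weightKernel X u k l)) := by
          refine schurNorm_mono fun k l => ?_
          have h : weightKernel X w k l ≤ ENNReal.ofReal 2
              + ENNReal.ofReal (ε / (2 * (σ + 1))) * weightKernel X u k l := by
            rw [weightKernel, weightKernel, ← ENNReal.ofReal_mul (by positivity),
              ← ENNReal.ofReal_add (by norm_num) (mul_nonneg (by positivity) (huw.pos _).le)]
            exact ENNReal.ofReal_le_ofReal (hw2 _)
          exact (mul_le_mul_right h _).trans_eq (by ring)
      _ ≤ ENNReal.ofReal 2 * schurNorm (fun _ _ => 1) (entryEnorm P)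
            + ENNReal.ofReal (ε / (2 * (σ + 1))) *
              schurNorm (weightKernel X u) (entryEnorm P) := by
          refine schurNorm_add_le.trans (add_le_add (schurNorm_smul _).le ?_)
          rw [schurNorm_smul]
          exact mul_le_mul_right (schurNorm_mono fun k l => by rw [mul_one]) _
      _ ≤ ENNReal.ofReal 2 * ENNReal.ofReal (ε / 4)
            + ENNReal.ofReal (ε / (2 * (σ + 1))) * ENNReal.ofReal σ := by
          gcongr
          rw [hσ, ENNReal.ofReal_toReal hP.1]
      _ ≤ ENNReal.ofReal ε := by
          rw [← ENNReal.ofReal_mul (by norm_num), ← ENNReal.ofReal_mul (by positivity),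
            ← ENNReal.ofReal_add (by positivity) (by positivity)]
          refine ENNReal.ofReal_le_ofReal ?_
          have h : ε / (2 * (σ + 1)) * σ ≤ ε / 2 := by
            rw [div_mul_eq_mul_div, div_le_div_iff₀ (by positivity) (by norm_num)]
            nlinarith
          linarith
  have hquarter : ENNReal.ofReal (1 / 4) = 4⁻¹ := by
    rw [one_div, ENNReal.ofReal_inv_of_pos (by norm_num), ENNReal.ofReal_ofNat]
  have hP4 : schurNorm (weightKernel X w) (entryEnorm P) ≤ 4⁻¹ := by
    rw [← hquarter]
    refine hPw.trans (ENNReal.ofReal_le_ofReal ?_)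
    rw [hε]
    gcongr
    linarith
  have hcP4 : ENNReal.ofReal (2 ^ s) * schurNorm (weightKernel X w) (entryEnorm P) ≤ 4⁻¹ := by
    rw [← hquarter]
    refine (mul_le_mul_right hPw _).trans ?_
    rw [← ENNReal.ofReal_mul (by positivity)]
    refine ENNReal.ofReal_le_ofReal (le_of_eq ?_)
    rw [hε]
    field_simp
  have hPnorm : ‖P‖ < 1 :=
    (norm_pow_le' R (by positivity)).trans_lt (pow_lt_one₀ (norm_nonneg _) hc1 (by positivity))
  have hPdecay : HasDecay (weightKernel X w) (weightKernel X fun x => w x * (1 + ‖x‖) ^ s) P := by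
    refine hP.mono_weight ENNReal.one_ne_top (fun k l => ?_) fun k l => ?_
    · rw [one_mul]
      exact ENNReal.ofReal_le_ofReal (hwu _)
    · rw [one_mul]
      exact ENNReal.ofReal_le_ofReal (mul_le_mul_of_nonneg_right (hwu _) (by positivity))
  have hV := hPdecay.tsum_pow hc hw.weightKernel_self_le hw.weightKernel_le_mul
    hws.weightKernel_self_le (hw.weightKernel_mul_rpow_le hs) hP4 hcP4
    (summable_geometric_of_norm_lt_one hPnorm)
  have hVu : HasDecay (weightKernel X u) (weightKernel X fun x => u x * (1 + ‖x‖) ^ s)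
      (∑' j : ℕ, P ^ j) := by
    refine hV.mono_weight (C := ENNReal.ofReal C) ENNReal.ofReal_ne_top (fun k l => ?_)
      fun k l => ?_
    · rw [weightKernel, weightKernel, ← ENNReal.ofReal_mul' (hw.pos _).le]
      exact ENNReal.ofReal_le_ofReal (huC _)
    · rw [weightKernel, weightKernel, ← ENNReal.ofReal_mul' (hws.pos _).le, ← mul_assoc]
      exact ENNReal.ofReal_le_ofReal (mul_le_mul_of_nonneg_right (huC _) (by positivity))
  rw [inverse_eq_tsum_pow_mul hTS hRdef hPnorm]
  exact hmul (hmul hVu (HasDecay.sum _ fun i _ => hpow hR i)) (hTadj.smul c)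

end WeightKernels

theorem statement14 {d : ℕ} (X : Set (Euc d)) (hX : RelSep X)
    (H : Type*) [NormedAddCommGroup H] [InnerProductSpace ℂ H] [CompleteSpace H]
    [TopologicalSpace.SeparableSpace H]
    (u : Euc d → ℝ) (huc : Continuous u) (hupos : ∀ x, 0 < u x) (hu : Admissible u)
    (δ s : ℝ) (hδ : 0 < δ) (hs : 0 < s)
    (hgrowth : ∀ x : Euc d, (1 + ‖x‖) ^ δ ≤ u x)
    (A : ↥X → ↥X → (H →L[ℂ] H))
    (hASchur : MemSchur1 u A)
    (hAJ : MemJnu (fun x : Euc d => u x * (1 + ‖x‖) ^ s) A)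
    (T : lp (fun _ : ↥X => H) 2 →L[ℂ] lp (fun _ : ↥X => H) 2)
    (hT : ∀ (f : lp (fun _ : ↥X => H) 2) (k : ↥X), T f k = ∑' l : ↥X, A k l (f l))
    (S : lp (fun _ : ↥X => H) 2 →L[ℂ] lp (fun _ : ↥X => H) 2)
    (hST : S.comp T = ContinuousLinearMap.id ℂ _)
    (hTS : T.comp S = ContinuousLinearMap.id ℂ _) :
    ∃ B : ↥X → ↥X → (H →L[ℂ] H),
      (∀ (k l : ↥X) (f : H), B k l f = (S (deltaSeq 2 l f)) k) ∧
      MemSchur1 u B ∧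
      MemJnu (fun x : Euc d => u x * (1 + ‖x‖) ^ s) B := by
  have hentry : entryEnorm T = fun k l => ‖A k l‖ₑ := by
    funext k l
    rw [entryEnorm, opEntry_eq_of_forall_apply_eq_tsum A T hT]
  have hdecay : HasDecay (weightKernel X u) (weightKernel X fun x => u x * (1 + ‖x‖) ^ s) T := by
    rw [HasDecay, hentry, ← memSchur1_iff fun x => (hupos x).le, ← memJnu_iff _]
    exact ⟨hASchur, hAJ⟩
  have hS := hdecay.of_inverse hX hu hδ hs.le hgrowth hST hTS
  exact ⟨opEntry S, opEntry_apply S, (memSchur1_iff (fun x => (hupos x).le) _).2 hS.1,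
    (memJnu_iff _ _).2 hS.2⟩
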